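/- arXiv:math/0404452 — 3 statements merged into one kernel-verified Lean document; each statement's English description precedes it below -/
import Mathlib

section
/- Let F be a homogeneous sextic form in 4 complex variables defining the surface S = Z(F) ⊂ P^3. Suppose the singular locus Σ of S is finite, consists only of simple double points, and #Σ ≤ 14. Then Σ imposes independent conditions on quintics: the linear evaluation map from the space of homogeneous quintic forms in 4 variables to ℂ^Σ is surjective; equivalently, for every p ∈ Σ there is a homogeneous quintic form vanishing at all points of Σ ∖ {p} and not vanishing at p. (This is the polynomial-level content of the first half of Theorem B: by Clemens' criterion it implies that the double cover of P^3 ramified along S is ℚ-factorial.) -/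
open MvPolynomial

/-- A point of `ℙ³(ℂ)` (projectivization of `ℂ⁴`). -/
abbrev ProjP3 := Projectivization ℂ (Fin 4 → ℂ)

/-- `p` is a singular point of the surface `Z(F) ⊂ ℙ³`: all four partial
derivatives of `F` vanish at a representative of `p`. -/
def IsSingularPt (F : MvPolynomial (Fin 4) ℂ) (p : ProjP3) : Prop :=
  ∀ i : Fin 4, eval p.rep (pderiv i F) = 0

/-- `p` is a simple double point (node) of `Z(F)`: the 4×4 Hessian matrix of
second partial derivatives of `F` at a representative of `p` has rank 3. -/
def IsNodePt (F : MvPolynomial (Fin 4) ℂ) (p : ProjP3) : Prop :=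
  (Matrix.of fun (i j : Fin 4) => eval p.rep (pderiv i (pderiv j F))).rank = 3
namespace SexticNodes

/-- The points of `Γ` impose independent conditions on forms of degree `d`. -/
def Ind {ι : Type*} {n : ℕ} (v : ι → Fin n → ℂ) (d : ℕ) (Γ : Finset ι) : Prop :=
  ∀ p ∈ Γ, ∃ G : MvPolynomial (Fin n) ℂ, G.IsHomogeneous d ∧ eval (v p) G ≠ 0 ∧
    ∀ q ∈ Γ, q ≠ p → eval (v q) G = 0

/-- Every projective line contains at most `k` of the points of `Γ`. -/
def LB {ι : Type*} {n : ℕ} (v : ι → Fin n → ℂ) (Γ : Finset ι) (k : ℕ) : Prop :=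
  ∀ W : Submodule ℂ (Fin n → ℂ), Module.finrank ℂ W ≤ 2 → ∀ A ⊆ Γ, (∀ i ∈ A, v i ∈ W) →
    A.card ≤ k

/-- The vectors `v i` represent pairwise distinct projective points. -/
def PW {ι : Type*} {n : ℕ} (v : ι → Fin n → ℂ) : Prop :=
  (∀ i, v i ≠ 0) ∧ ∀ i j, i ≠ j → v i ∉ Submodule.span ℂ {v j}

variable {ι : Type*} {n : ℕ} {v : ι → Fin n → ℂ}

lemma Ind.mono {d : ℕ} {Γ Δ : Finset ι} (h : Ind v d Γ) (hs : Δ ⊆ Γ) : Ind v d Δ := by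
  intro p hp
  obtain ⟨G, h1, h2, h3⟩ := h p (hs hp)
  exact ⟨G, h1, h2, fun q hq => h3 q (hs hq)⟩

lemma LB.mono {k l : ℕ} {Γ Δ : Finset ι} (h : LB v Γ k) (hs : Δ ⊆ Γ) (hkl : k ≤ l) :
    LB v Δ l := fun W hW A hA hAW => (h W hW A (hA.trans hs) hAW).trans hkl

lemma exists_form (f : (Fin n → ℂ) →ₗ[ℂ] ℂ) :
    ∃ G : MvPolynomial (Fin n) ℂ, G.IsHomogeneous 1 ∧ ∀ x, eval x G = f x := by
  refine ⟨∑ i, C (f (Pi.single i 1)) * X i, ?_, ?_⟩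
  · exact IsHomogeneous.sum _ _ _ fun i _ => isHomogeneous_C_mul_X _ _
  · intro x
    conv_rhs => rw [← LinearMap.sum_single_apply (fun _ => ℂ) x, map_sum]
    rw [map_sum]
    refine Finset.sum_congr rfl fun i _ => ?_
    have : (LinearMap.single ℂ (fun _ => ℂ) i (x i) : Fin n → ℂ)
        = x i • (Pi.single i (1 : ℂ) : Fin n → ℂ) := by
      ext j; by_cases h : j = i
      · subst h; simp
      · simp [h]
    simp only [map_mul, eval_C, eval_X]
    rw [show (Pi.single i (x i) : Fin n → ℂ) = x i • (Pi.single i (1 : ℂ) : Fin n → ℂ) from this,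
      map_smul, smul_eq_mul, mul_comm]

/-- residual lemma -/
lemma residual {d e k : ℕ} {Γ A B : Finset ι} (K : MvPolynomial (Fin n) ℂ)
    (hK : K.IsHomogeneous k) (hd : d = e + k)
    (hAB : ∀ i ∈ Γ, (eval (v i) K = 0 ∧ i ∈ A) ∨ (eval (v i) K ≠ 0 ∧ i ∈ B))
    (hA : Ind v d A) (hB : Ind v e B) : Ind v d Γ := by
  classical
  intro p hp
  rcases hAB p hp with ⟨hp0, hpA⟩ | ⟨hp0, hpB⟩
  · obtain ⟨G, h1, h2, h3⟩ := hA p hpA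
    choose! H hH1 hH2 hH3 using hB
    refine ⟨G - ∑ q ∈ Γ.filter (fun q => eval (v q) K ≠ 0),
      C (eval (v q) G / (eval (v q) K * eval (v q) (H q))) * (K * H q), ?_, ?_, ?_⟩
    · refine h1.sub (IsHomogeneous.sum _ _ _ fun q hq => ?_)
      have hqB : q ∈ B := by
        rw [Finset.mem_filter] at hq
        rcases hAB q hq.1 with h | h
        · exact absurd h.1 hq.2
        · exact h.2
      rw [hd, add_comm]
      exact (hK.mul (hH1 q hqB)).C_mul _
    · simp [hp0, h2]
    · intro q hq hqp
      rw [map_sub, map_sum, sub_eq_zero]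
      rcases hAB q hq with ⟨hq0, hqA⟩ | ⟨hq0, hqB⟩
      · rw [h3 q hqA hqp]
        simp [hq0]
      · rw [Finset.sum_eq_single_of_mem q (by simp [hq, hq0])]
        · have := hH2 q hqB
          simp
          field_simp
        · intro r hr hrq
          rw [Finset.mem_filter] at hr
          have hrB : r ∈ B := by
            rcases hAB r hr.1 with h | h
            · exact absurd h.1 hr.2
            · exact h.2
          simp [hH3 r hrB q hqB hrq.symm]
  · obtain ⟨G, h1, h2, h3⟩ := hB p hpB
    refine ⟨G * K, hd ▸ h1.mul hK, by simp [h2, hp0], fun q hq hqp => ?_⟩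
    rcases hAB q hq with ⟨hq0, hqA⟩ | ⟨hq0, hqB⟩
    · simp [hq0]
    · simp [h3 q hqB hqp]

/-- generic linear form vanishing on `W` -/
lemma generic (W : Submodule ℂ (Fin n → ℂ)) (A : Finset ι) (hA : ∀ i ∈ A, v i ∉ W) :
    ∃ f : (Fin n → ℂ) →ₗ[ℂ] ℂ, (∀ w ∈ W, f w = 0) ∧ ∀ i ∈ A, f (v i) ≠ 0 := by
  obtain ⟨f, hf, hf'⟩ := Module.Dual.exists_forall_mem_ne_zero_of_forall_exists (K := ℂ)
    (M := Module.Dual ℂ (Fin n → ℂ)) W.dualAnnihilator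
    (fun i : A => Module.Dual.eval ℂ (Fin n → ℂ) (v i)) (by
      rintro ⟨i, hi⟩
      obtain ⟨f, h1, h2⟩ := Submodule.exists_le_ker_of_notMem (hA i hi)
      refine ⟨f, ?_, h1⟩
      rw [Submodule.mem_dualAnnihilator]
      exact fun w hw => h2 hw)
  refine ⟨f, ?_, fun i hi => hf' ⟨i, hi⟩⟩
  rwa [Submodule.mem_dualAnnihilator] at hf

lemma exists_form_ne {x : Fin n → ℂ} (hx : x ≠ 0) :
    ∃ G : MvPolynomial (Fin n) ℂ, G.IsHomogeneous 1 ∧ eval x G ≠ 0 := by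
  obtain ⟨f, hf, -⟩ := Submodule.exists_le_ker_of_notMem (K := ℂ) (p := ⊥) (v := x) (by simpa)
  obtain ⟨G, h1, h2⟩ := exists_form f
  exact ⟨G, h1, by rwa [h2]⟩

/-- at most `d+1` points are always independent in degree `d`. -/
lemma indT (hv : PW v) {d : ℕ} {Γ : Finset ι} (h : Γ.card ≤ d + 1) : Ind v d Γ := by
  classical
  intro p hp
  have hq : ∀ q, q ≠ p → ∃ G : MvPolynomial (Fin n) ℂ, G.IsHomogeneous 1 ∧
      eval (v p) G ≠ 0 ∧ eval (v q) G = 0 := by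
    intro q hqp
    obtain ⟨f, h1, h2⟩ := Submodule.exists_le_ker_of_notMem (hv.2 p q hqp.symm)
    obtain ⟨G, h3, h4⟩ := exists_form f
    exact ⟨G, h3, by rwa [h4], by rw [h4]; exact h2 (Submodule.mem_span_singleton_self _)⟩
  choose! G hG1 hG2 hG3 using hq
  obtain ⟨L, hL1, hL2⟩ := exists_form_ne (hv.1 p)
  have hc : (Γ.erase p).card ≤ d := by rw [Finset.card_erase_of_mem hp]; omega
  refine ⟨(∏ q ∈ Γ.erase p, G q) * L ^ (d - (Γ.erase p).card), ?_, ?_, ?_⟩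
  · have h1 := IsHomogeneous.prod (Γ.erase p) G (fun _ => 1)
      (fun q hq => hG1 q (Finset.ne_of_mem_erase hq))
    have h2 := h1.mul (hL1.pow (d - (Γ.erase p).card))
    convert h2 using 1
    simp; omega
  · rw [map_mul, map_pow, map_prod]
    refine mul_ne_zero (Finset.prod_ne_zero_iff.2 fun q hq => hG2 q (Finset.ne_of_mem_erase hq))
      (pow_ne_zero _ hL2)
  · intro q hq hqp
    rw [map_mul, map_prod, Finset.prod_eq_zero (Finset.mem_erase.2 ⟨hqp, hq⟩) (hG3 q hqp), zero_mul]

/-- a line with the maximal number of points -/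
lemma exists_max_line (v : ι → Fin n → ℂ) (Γ : Finset ι) :
    ∃ W : Submodule ℂ (Fin n → ℂ), Module.finrank ℂ W ≤ 2 ∧ ∃ A ⊆ Γ, (∀ i ∈ A, v i ∈ W) ∧
      (∀ i ∈ Γ, v i ∈ W → i ∈ A) ∧ LB v Γ A.card := by
  classical
  let P : ℕ → Prop := fun m => ∃ W : Submodule ℂ (Fin n → ℂ), Module.finrank ℂ W ≤ 2 ∧
    ∃ A ⊆ Γ, (∀ i ∈ A, v i ∈ W) ∧ A.card = m
  have hP0 : P 0 := ⟨⊥, by simp, ∅, by simp, by simp, rfl⟩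
  have hb : ∀ m, P m → m ≤ Γ.card := by
    rintro m ⟨W, _, A, hA, _, rfl⟩; exact Finset.card_le_card hA
  obtain ⟨W, hW, A, hA, hAW, hAm⟩ := Nat.findGreatest_spec (P := P) (Nat.zero_le Γ.card) hP0
  have hmax : LB v Γ (Nat.findGreatest P Γ.card) := fun W' hW' A' hA' hAW' =>
    Nat.le_findGreatest (Finset.card_le_card hA') ⟨W', hW', A', hA', hAW', rfl⟩
  have hcard : Γ.filter (fun i => v i ∈ W) = A := by
    symm
    apply Finset.eq_of_subset_of_card_le
    · intro i hi; simp [hA hi, hAW i hi]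
    · rw [hAm]; exact hmax W hW _ (Finset.filter_subset _ _) (by simp)
  refine ⟨W, hW, A, hA, hAW, ?_, hAm ▸ hmax⟩
  intro i hi hiW
  rw [← hcard]; simp [hi, hiW]

lemma finrank_pair (x y : Fin n → ℂ) : Module.finrank ℂ (Submodule.span ℂ {x, y}) ≤ 2 := by
  classical
  have := finrank_span_le_card (R := ℂ) ({x, y} : Set (Fin n → ℂ))
  refine this.trans ?_
  simpa using Finset.card_le_two (a := x) (b := y)

lemma LB.card_le_one {Γ : Finset ι} {k : ℕ} (h : LB v Γ k) (hk : k ≤ 1) : Γ.card ≤ 1 := by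
  classical
  by_contra hc
  obtain ⟨i, hi, j, hj, hij⟩ := Finset.one_lt_card.1 (not_le.1 hc)
  have := h (Submodule.span ℂ {v i, v j}) (finrank_pair _ _) {i, j}
    (by intro x; simp; rintro (rfl | rfl) <;> assumption)
    (by intro x; simp; rintro (rfl | rfl) <;> exact Submodule.subset_span (by simp))
  rw [Finset.card_pair hij] at this
  omega

/-- peel off a line -/
lemma peel {d e : ℕ} (hd : d = e + 1) {Γ A : Finset ι} (W : Submodule ℂ (Fin n → ℂ))
    (hAW : ∀ i ∈ Γ, v i ∈ W → i ∈ A) (hAW' : ∀ i ∈ A, v i ∈ W) [DecidableEq ι]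
    (hA : Ind v d A) (hB : Ind v e (Γ \ A)) : Ind v d Γ := by
  obtain ⟨f, hf1, hf2⟩ := generic (v := v) W (Γ \ A) (by
    intro i hi hW; rw [Finset.mem_sdiff] at hi; exact hi.2 (hAW i hi.1 hW))
  obtain ⟨G, hG1, hG2⟩ := exists_form f
  refine residual G hG1 hd ?_ hA hB
  intro i hi
  by_cases hiA : i ∈ A
  · left; exact ⟨by rw [hG2]; exact hf1 _ (hAW' i hiA), hiA⟩
  · right
    have : i ∈ Γ \ A := by simp [hi, hiA]
    exact ⟨by rw [hG2]; exact hf2 i this, this⟩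

/-- at most `2e+1` points with at most `e+1` on a line are independent in degree `e`. -/
lemma indS (hv : PW v) (e : ℕ) : ∀ Γ : Finset ι, Γ.card ≤ 2 * e + 1 → LB v Γ (e + 1) →
    Ind v e Γ := by
  classical
  induction e with
  | zero => intro Γ h _; exact indT hv (by omega)
  | succ e ih =>
    intro Γ h hL
    obtain ⟨W, hW, A, hA, hAW, hAW', hm⟩ := exists_max_line v Γ
    by_cases h1 : A.card ≤ 1
    · exact indT hv (by have := hm.card_le_one h1; omega)
    have hc := Finset.card_sdiff_add_card_eq_card hA
    refine peel rfl W hAW' hAW (indT hv (hL W hW A hA hAW)) (ih _ (by omega) ?_)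
    intro W' hW' A' hA' hAW''
    by_contra hcon
    have h2 := hm W' hW' A' (hA'.trans Finset.sdiff_subset) hAW''
    have h3 := Finset.card_le_card hA'
    omega

lemma finrank_homog (d : ℕ) :
    Module.finrank ℂ (homogeneousSubmodule (Fin 3) ℂ d) = (d + 2).choose d := by
  classical
  have e := LinearEquiv.ofEq _ _ (homogeneousSubmodule_eq_finsupp_supported (Fin 3) ℂ d)
  have e2 := e.trans (AddMonoidAlgebra.supportedEquivFinsupp (R := ℂ) (S := ℂ)
    {x : Fin 3 →₀ ℕ | x.degree = d})
  have hs : {x : Fin 3 →₀ ℕ | x.degree = d}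
      = ((Finset.univ : Finset (Fin 3)).finsuppAntidiag d : Set (Fin 3 →₀ ℕ)) := by
    ext x
    simp [Finsupp.degree_eq_sum]
  rw [hs] at e2
  rw [e2.finrank_eq, Module.finrank_finsupp_self]
  simp only [Finset.coe_sort_coe, Fintype.card_coe]
  rw [Finset.card_finsuppAntidiag_nat_eq_choose]
  simp
  congr 1
  omega

instance (d : ℕ) : Module.Finite ℂ (homogeneousSubmodule (Fin 3) ℂ d) :=
  Module.Finite.iff_fg.2 (homogeneousSubmodule_fg (Fin 3) ℂ d)

/-- Evaluation of forms of degree `d` at the points of `A`. -/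
noncomputable def evL (v : ι → Fin n → ℂ) (d : ℕ) (A : Finset ι) :
    homogeneousSubmodule (Fin n) ℂ d →ₗ[ℂ] (A → ℂ) where
  toFun G := fun i => eval (v i) G.1
  map_add' G H := by ext; simp
  map_smul' c G := by ext; simp [MvPolynomial.smul_eval]

lemma exists_through {w : ι → Fin 3 → ℂ} (d : ℕ) (A : Finset ι)
    (h : A.card < (d + 2).choose d) :
    ∃ K : MvPolynomial (Fin 3) ℂ, K ≠ 0 ∧ K.IsHomogeneous d ∧ ∀ i ∈ A, eval (w i) K = 0 := by
  have h1 := LinearMap.finrank_range_add_finrank_ker (evL w d A)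
  have h2 := Submodule.finrank_le (LinearMap.range (evL w d A))
  rw [Module.finrank_fintype_fun_eq_card, Fintype.card_coe] at h2
  rw [finrank_homog] at h1
  have h3 : 0 < Module.finrank ℂ (LinearMap.ker (evL w d A)) := by omega
  obtain ⟨⟨⟨K, hK⟩, hK'⟩, hne⟩ := (Module.finrank_pos_iff_exists_ne_zero (R := ℂ)
    (M := LinearMap.ker (evL w d A))).1 h3
  refine ⟨K, fun h => hne (by ext1; ext1; exact h), hK, fun i hi => ?_⟩
  exact congrFun (LinearMap.mem_ker.1 hK') ⟨i, hi⟩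

lemma exists_lin {a : MvPolynomial (Fin n) ℂ} (ha : a.IsHomogeneous 1) :
    ∃ f : (Fin n → ℂ) →ₗ[ℂ] ℂ, ∀ x, eval x a = f x := by
  rw [← mem_homogeneousSubmodule, homogeneousSubmodule_one_eq_span_X] at ha
  induction ha using Submodule.span_induction with
  | mem x hx => obtain ⟨i, rfl⟩ := hx; exact ⟨LinearMap.proj i, by simp⟩
  | zero => exact ⟨0, by simp⟩
  | add a b _ _ h1 h2 =>
    obtain ⟨f, hf⟩ := h1; obtain ⟨g, hg⟩ := h2; exact ⟨f + g, by simp [hf, hg]⟩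
  | smul c a _ h1 => obtain ⟨f, hf⟩ := h1; exact ⟨c • f, by simp [hf, smul_eval]⟩

open scoped Pointwise in
lemma quad_bilin {K : MvPolynomial (Fin n) ℂ} (hK : K.IsHomogeneous 2) :
    ∃ B : (Fin n → ℂ) →ₗ[ℂ] (Fin n → ℂ) →ₗ[ℂ] ℂ, ∀ x, eval x K = B x x := by
  have hm : K ∈ Submodule.span ℂ (((homogeneousSubmodule (Fin n) ℂ 1 : Set (MvPolynomial (Fin n) ℂ)) *
      (homogeneousSubmodule (Fin n) ℂ 1 : Set (MvPolynomial (Fin n) ℂ)))) := by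
    rw [← Submodule.span_mul_span, Submodule.span_eq, ← pow_two, homogeneousSubmodule_one_pow]
    exact hK
  clear hK
  induction hm using Submodule.span_induction with
  | mem x hx =>
    obtain ⟨a, ha, b, hb, rfl⟩ := hx
    obtain ⟨f, hf⟩ := exists_lin ha
    obtain ⟨g, hg⟩ := exists_lin hb
    exact ⟨LinearMap.mk₂ ℂ (fun x y => f x * g y) (by intros; simp; ring) (by intros; simp; ring)
      (by intros; simp; ring) (by intros; simp; ring), by simp [hf, hg]⟩
  | zero => exact ⟨0, by simp⟩
  | add a b _ _ h1 h2 =>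
    obtain ⟨f, hf⟩ := h1; obtain ⟨g, hg⟩ := h2; exact ⟨f + g, by simp [hf, hg]⟩
  | smul c a _ h1 => obtain ⟨f, hf⟩ := h1; exact ⟨c • f, by simp [hf, smul_eval]⟩


lemma finrank_ker_le {f : (Fin 3 → ℂ) →ₗ[ℂ] ℂ} (hf : f ≠ 0) :
    Module.finrank ℂ (LinearMap.ker f) = 2 := by
  have := Module.Dual.finrank_ker_add_one_of_ne_zero (K := ℂ) (f := f) hf
  simp at this
  omega

lemma conic_split {w : ι → Fin 3 → ℂ} {K : MvPolynomial (Fin 3) ℂ}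
    (hK0 : K ≠ 0) (f g : (Fin 3 → ℂ) →ₗ[ℂ] ℂ) (hfg : ∀ x, eval x K = f x * g x)
    {A : Finset ι} (hA : LB w A 2) (hAK : ∀ i ∈ A, eval (w i) K = 0) : A.card ≤ 4 := by
  classical
  have hf : f ≠ 0 := by
    rintro rfl; exact hK0 (MvPolynomial.funext fun x => by simp [hfg])
  have hg : g ≠ 0 := by
    rintro rfl; exact hK0 (MvPolynomial.funext fun x => by simp [hfg])
  have h1 := hA (LinearMap.ker f) (finrank_ker_le hf).le (A.filter fun i => f (w i) = 0)
    (Finset.filter_subset _ _) (by simp)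
  have h2 := hA (LinearMap.ker g) (finrank_ker_le hg).le (A.filter fun i => ¬ f (w i) = 0)
    (Finset.filter_subset _ _) (by
      intro i hi
      rw [Finset.mem_filter] at hi
      have := hAK i hi.1
      rw [hfg] at this
      exact (mul_eq_zero.1 this).resolve_left hi.2)
  have := Finset.card_filter_add_card_filter_not (s := A) (fun i => f (w i) = 0)
  omega

lemma conic_ntc {w : ι → Fin 3 → ℂ} (hw : PW w) {K : MvPolynomial (Fin 3) ℂ} (hK : K.IsHomogeneous 2)
    (hK0 : K ≠ 0) {A B : Finset ι} (hA : LB w A 2) (hAK : ∀ i ∈ A, eval (w i) K = 0)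
    (hA5 : 5 ≤ A.card) (hBK : ∀ i ∈ B, eval (w i) K = 0) : LB w B 2 := by
  classical
  obtain ⟨Q, hQ⟩ := quad_bilin hK
  intro W hW D hD hDW
  by_contra hc
  obtain ⟨i, j, k, hi, hj, hk, hij, hik, hjk⟩ := Finset.two_lt_card_iff.1 (not_le.1 hc)
  have hWt : ∃ c, c ∉ W := by
    by_contra hcon
    push Not at hcon
    have : W = ⊤ := by ext x; simp [hcon x]
    rw [this] at hW
    simp at hW
  obtain ⟨c, hc⟩ := hWt
  obtain ⟨f, hfc, hf⟩ := Submodule.exists_le_ker_of_notMem hc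
  have hf0 : f ≠ 0 := by rintro rfl; simp at hfc
  have hli : LinearIndependent ℂ ![w i, w j] := by
    rw [LinearIndependent.pair_iff' (hw.1 i)]
    intro a ha
    exact hw.2 j i hij.symm (ha ▸ Submodule.smul_mem _ _ (Submodule.mem_span_singleton_self _))
  have hspan : Submodule.span ℂ {w i, w j} = LinearMap.ker f := by
    apply Submodule.eq_of_le_of_finrank_le
    · rw [Submodule.span_le]
      rintro x (rfl | rfl)
      · exact hf (hDW i hi)
      · exact hf (hDW j hj)
    · rw [finrank_ker_le hf0]
      have := finrank_span_eq_card hli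
      have hr : Set.range ![w i, w j] = {w i, w j} := by
        ext x; simp [or_comm]
      rw [hr] at this
      simp [this]
  have hmem : ∀ x, f x = 0 → ∃ s t : ℂ, s • w i + t • w j = x := by
    intro x hx
    have : x ∈ Submodule.span ℂ {w i, w j} := by rw [hspan]; exact hx
    exact Submodule.mem_span_pair.1 this
  have hii : Q (w i) (w i) = 0 := by rw [← hQ]; exact hBK i (hD hi)
  have hjj : Q (w j) (w j) = 0 := by rw [← hQ]; exact hBK j (hD hj)
  have hkk : Q (w k) (w k) = 0 := by rw [← hQ]; exact hBK k (hD hk)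
  obtain ⟨s, t, hst⟩ := hmem (w k) (hf (hDW k hk))
  have hs : s ≠ 0 := by
    rintro rfl
    exact hw.2 k j hjk.symm (Submodule.mem_span_singleton.2 ⟨t, by simpa using hst⟩)
  have ht : t ≠ 0 := by
    rintro rfl
    exact hw.2 k i hik.symm (Submodule.mem_span_singleton.2 ⟨s, by simpa using hst⟩)
  have hcross : Q (w i) (w j) + Q (w j) (w i) = 0 := by
    rw [← hst] at hkk
    simp [hii, hjj] at hkk
    have : s * t * (Q (w i) (w j) + Q (w j) (w i)) = 0 := by linear_combination hkk
    simpa [hs, ht] using this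
  have hker : ∀ x, f x = 0 → Q x x = 0 := by
    intro x hx
    obtain ⟨s, t, rfl⟩ := hmem x hx
    simp [hii, hjj]
    linear_combination s * t * hcross
  have := conic_split (w := w) hK0 f ((f c)⁻¹ • (Q.flip c + Q c) - (Q c c / (f c) ^ 2) • f) (by
    intro x
    have h0 := hker (x - (f x / f c) • c) (by simp; field_simp; simp)
    simp at h0
    rw [hQ]
    simp
    field_simp
    field_simp at h0
    linear_combination h0) hA hAK
  omega

lemma ntc_li {w : ι → Fin 3 → ℂ} {A : Finset ι} (hA : LB w A 2) {i j k : ι}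
    (hi : i ∈ A) (hj : j ∈ A) (hk : k ∈ A) (hij : i ≠ j) (hik : i ≠ k) (hjk : j ≠ k) :
    LinearIndependent ℂ ![w i, w j, w k] := by
  classical
  rw [linearIndependent_iff_card_le_finrank_span]
  by_contra hc
  rw [not_le] at hc
  have := hA (Submodule.span ℂ (Set.range ![w i, w j, w k])) (by
    simp [Set.finrank] at hc; simp; omega) {i, j, k}
    (by intro x; simp; rintro (rfl | rfl | rfl) <;> assumption)
    (by intro x; simp; rintro (rfl | rfl | rfl) <;> exact Submodule.subset_span (by simp))
  rw [Finset.card_eq_three.2 ⟨i, j, k, hij, hik, hjk, rfl⟩] at this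
  omega

/-- A form of degree `d` restricted to a polynomially parametrized curve. -/
lemma param_vanish {d m : ℕ} {G : MvPolynomial (Fin n) ℂ} (hG : G.IsHomogeneous d)
    (P : Fin n → Polynomial ℂ) (hP : ∀ i, (P i).natDegree ≤ m) (S : Finset ℂ)
    (hS : d * m < S.card) (hv : ∀ t ∈ S, eval (fun i => (P i).eval t) G = 0) (t : ℂ) :
    eval (fun i => (P i).eval t) G = 0 := by
  have key : ∀ t, (aeval P G).eval t = eval (fun i => (P i).eval t) G := by
    intro t
    have := MvPolynomial.eval₂_comp_left (Polynomial.evalRingHom t) (algebraMap ℂ (Polynomial ℂ)) P G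
    rw [MvPolynomial.aeval_def, ← Polynomial.coe_evalRingHom, this]
    have h2 : (Polynomial.evalRingHom t).comp (algebraMap ℂ (Polynomial ℂ)) = RingHom.id ℂ := by
      ext x; simp
    rw [h2]
    rfl
  have hz : aeval P G = 0 := by
    apply Polynomial.eq_zero_of_natDegree_lt_card_of_eval_eq_zero' _ S
    · intro t ht; rw [key]; exact hv t ht
    · exact lt_of_le_of_lt (aeval_natDegree_le G hG.totalDegree_le P hP) hS
  rw [← key, hz]; simp

lemma eval_smul' {d : ℕ} {G : MvPolynomial (Fin n) ℂ} (hG : G.IsHomogeneous d) (c : ℂ)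
    (x : Fin n → ℂ) : eval (c • x) G = c ^ d * eval x G := by
  rw [eval_eq, eval_eq, Finset.mul_sum]
  refine Finset.sum_congr rfl fun m hm => ?_
  have := hG.degree_eq_sum_deg_support hm
  simp only [Pi.smul_apply, smul_eq_mul, mul_pow, Finset.prod_mul_distrib]
  rw [Finset.prod_pow_eq_pow_sum, ← this]
  ring

lemma conic_param {w : ι → Fin 3 → ℂ} (hw : PW w) {K : MvPolynomial (Fin 3) ℂ}
    (hK : K.IsHomogeneous 2)
    (hK0 : K ≠ 0) {A : Finset ι} (hA : LB w A 2) (hAK : ∀ i ∈ A, eval (w i) K = 0)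
    (hA12 : 12 ≤ A.card) :
    ∃ u : ℂ → Fin 3 → ℂ, ∃ T : Set ℂ, T.Infinite ∧ (∀ t ∈ T, u t ≠ 0) ∧
      (∀ s ∈ T, ∀ t ∈ T, s ≠ t → u s ∉ Submodule.span ℂ {u t}) ∧
      ∀ G : MvPolynomial (Fin 3) ℂ, G.IsHomogeneous 5 → (∀ i ∈ A, eval (w i) G = 0) →
        ∀ t, eval (u t) G = 0 := by
  classical
  obtain ⟨Q, hQ⟩ := quad_bilin hK
  obtain ⟨i, j, k, hi, hj, hk, hij, hik, hjk⟩ := Finset.two_lt_card_iff.1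
    (show 2 < A.card by omega)
  have hli := ntc_li hA hi hj hk hij hik hjk
  let bs := basisOfLinearIndependentOfCardEqFinrank hli (by simp)
  have hbs : ∀ m, bs m = ![w i, w j, w k] m := fun m => by simp [bs]
  obtain ⟨X', hX'⟩ : ∃ f, f = bs.coord 0 := ⟨_, rfl⟩
  obtain ⟨Y', hY'⟩ : ∃ f, f = bs.coord 1 := ⟨_, rfl⟩
  obtain ⟨Z', hZ'⟩ : ∃ f, f = bs.coord 2 := ⟨_, rfl⟩
  have hrep : ∀ q, q = X' q • w i + Y' q • w j + Z' q • w k := by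
    intro q
    have := bs.sum_repr q
    rw [Fin.sum_univ_three] at this
    rw [hX', hY', hZ']
    conv_lhs => rw [← this]
    simp [hbs]
  have hcoord : ∀ x y z : ℂ, X' (x • w i + y • w j + z • w k) = x ∧
      Y' (x • w i + y • w j + z • w k) = y ∧ Z' (x • w i + y • w j + z • w k) = z := by
    have h0 : w i = bs 0 := by simp [hbs]
    have h1 : w j = bs 1 := by simp [hbs]
    have h2 : w k = bs 2 := by simp [hbs]
    intro x y z
    rw [h0, h1, h2, hX', hY', hZ']
    simp
  clear_value bs
  have hii : Q (w i) (w i) = 0 := by rw [← hQ]; exact hAK i hi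
  have hjj : Q (w j) (w j) = 0 := by rw [← hQ]; exact hAK j hj
  have hkk : Q (w k) (w k) = 0 := by rw [← hQ]; exact hAK k hk
  obtain ⟨α, hα⟩ : ∃ x, x = Q (w j) (w k) + Q (w k) (w j) := ⟨_, rfl⟩
  obtain ⟨β, hβ⟩ : ∃ x, x = Q (w i) (w k) + Q (w k) (w i) := ⟨_, rfl⟩
  obtain ⟨γ, hγ⟩ : ∃ x, x = Q (w i) (w j) + Q (w j) (w i) := ⟨_, rfl⟩
  have hform : ∀ q, eval q K = α * (Y' q * Z' q) + β * (X' q * Z' q) + γ * (X' q * Y' q) := by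
    intro q
    rw [hQ]
    conv_lhs => rw [hrep q]
    simp [hii, hjj, hkk, hα, hβ, hγ]
    ring
  have hα0 : α ≠ 0 := by
    intro h
    have := conic_split (w := w) hK0 X' (β • Z' + γ • Y') (by
      intro x; rw [hform]; simp [h]; ring) hA hAK
    omega
  have hβ0 : β ≠ 0 := by
    intro h
    have := conic_split (w := w) hK0 Y' (α • Z' + γ • X') (by
      intro x; rw [hform]; simp [h]; ring) hA hAK
    omega
  have hγ0 : γ ≠ 0 := by
    intro h
    have := conic_split (w := w) hK0 Z' (α • Y' + β • X') (by
      intro x; rw [hform]; simp [h]; ring) hA hAK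
    omega
  obtain ⟨om, hom⟩ : ∃ om : ℂ → ℂ, om = fun t => -(α * t + β) / γ := ⟨_, rfl⟩
  obtain ⟨u, hu⟩ : ∃ u : ℂ → Fin 3 → ℂ, u = fun t =>
    om t • w i + (t * om t) • w j + t • w k := ⟨_, rfl⟩
  have huX : ∀ t, X' (u t) = om t := fun t => by rw [hu]; exact (hcoord _ _ _).1
  have huY : ∀ t, Y' (u t) = t * om t := fun t => by rw [hu]; exact (hcoord _ _ _).2.1
  have hpt : ∀ q ∈ A, q ≠ j → ∃ t l : ℂ, w q = l • u t := by
    intro q hq hqj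
    have h0 := hAK q hq
    rw [hform] at h0
    have hr := hrep (w q)
    by_cases hx : X' (w q) = 0
    · simp [hx, hα0] at h0
      rcases h0 with hy | hz
      · refine ⟨-β / α, Z' (w q) * (-α / β), ?_⟩
        have : om (-β / α) = 0 := by rw [hom]; field_simp; ring
        rw [hu]
        simp only [this]
        conv_lhs => rw [hr, hx, hy]
        simp [smul_smul]
        congr 1
        field_simp
      · exfalso
        refine hw.2 q j hqj ?_
        rw [Submodule.mem_span_singleton]
        exact ⟨Y' (w q), by conv_rhs => rw [hr, hx, hz]
                            simp⟩
    · have hom1 : Z' (w q) * om (Y' (w q) / X' (w q)) = Y' (w q) := by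
        rw [hom]; field_simp; linear_combination -h0
      have hom0 : om (Y' (w q) / X' (w q)) ≠ 0 := by
        intro h
        rw [h, mul_zero] at hom1
        rw [← hom1, hom] at h
        simp [hβ0, hγ0] at h
      refine ⟨Y' (w q) / X' (w q), X' (w q) / om (Y' (w q) / X' (w q)), ?_⟩
      conv_lhs => rw [hr]
      rw [hu]
      simp only [smul_add, smul_smul]
      congr 2
      · congr 1; field_simp
      · congr 1; field_simp
      · field_simp
        exact hom1
  refine ⟨u, {t | om t ≠ 0}, ?_, ?_, ?_, ?_⟩
  · have : {t | om t ≠ 0} = ({-β / α} : Set ℂ)ᶜ := by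
      ext t
      simp [hom, hγ0]
      rw [not_iff_not]
      constructor
      · intro h; field_simp; linear_combination -h
      · rintro rfl; field_simp; ring
    rw [this]
    exact (Set.finite_singleton _).infinite_compl
  · intro t ht h
    apply ht
    rw [← huX, h]; simp
  · intro s hs t ht hst h
    rw [Submodule.mem_span_singleton] at h
    obtain ⟨l, hl⟩ := h
    have h1 := huX s
    have h2 := huY s
    rw [← hl] at h1 h2
    simp only [map_smul, huX, huY, smul_eq_mul] at h1 h2
    apply hst
    have h3 : om s * (t - s) = 0 := by linear_combination -t * h1 + h2
    have h4 := (mul_eq_zero.1 h3).resolve_left hs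
    linear_combination -h4
  · intro G hG hGA
    choose! τ l hτ using hpt
    let P : Fin 3 → Polynomial ℂ := fun m =>
      (Polynomial.C (-α / γ) * Polynomial.X + Polynomial.C (-β / γ)) * Polynomial.C (w i m) +
      Polynomial.X * (Polynomial.C (-α / γ) * Polynomial.X + Polynomial.C (-β / γ)) *
        Polynomial.C (w j m) + Polynomial.X * Polynomial.C (w k m)
    have hPu : ∀ t, (fun m => (P m).eval t) = u t := by
      intro t
      ext m
      simp [P, hu, hom]
      ring
    have := param_vanish hG P (m := 2) (by
      intro m
      simp only [P]
      compute_degree) ((A.erase j).image τ) (by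
        rw [Finset.card_image_of_injOn, Finset.card_erase_of_mem hj]
        · omega
        · intro q hq q' hq' hqq
          by_contra hne
          simp only [Finset.coe_erase, Set.mem_sdiff, Finset.mem_coe, Set.mem_singleton_iff] at hq hq'
          have e1 := hτ q hq.1 hq.2
          have e2 := hτ q' hq'.1 hq'.2
          rw [← hqq] at e2
          have l2 : l q' ≠ 0 := by
            intro h; rw [h, zero_smul] at e2; exact hw.1 _ e2
          apply hw.2 q q' hne
          rw [Submodule.mem_span_singleton]
          refine ⟨l q / l q', ?_⟩
          rw [e1, e2, smul_smul]
          congr 1; field_simp) (by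
        intro t ht
        rw [Finset.mem_image] at ht
        obtain ⟨q, hq, rfl⟩ := ht
        rw [Finset.mem_erase] at hq
        have e1 := hτ q hq.2 hq.1
        have h0 := hGA q hq.2
        rw [e1, eval_smul' hG] at h0
        rw [hPu]
        refine (mul_eq_zero.1 h0).resolve_left (pow_ne_zero _ ?_)
        intro h; rw [h, zero_smul] at e1; exact hw.1 _ e1)
    intro t
    rw [← hPu]
    exact this t

/-- Every conic contains at most `k` of the points of `Γ`. -/
def CB {ι : Type*} (w : ι → Fin 3 → ℂ) (Γ : Finset ι) (k : ℕ) : Prop :=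
  ∀ K : MvPolynomial (Fin 3) ℂ, K.IsHomogeneous 2 → K ≠ 0 → ∀ A ⊆ Γ,
    (∀ i ∈ A, eval (w i) K = 0) → A.card ≤ k

lemma CB.mono {w : ι → Fin 3 → ℂ} {k l : ℕ} {Γ Δ : Finset ι} (h : CB w Γ k) (hs : Δ ⊆ Γ)
    (hkl : k ≤ l) : CB w Δ l :=
  fun K hK hK0 A hA hAK => (h K hK hK0 A (hA.trans hs) hAK).trans hkl

/-- peel off a conic -/
lemma peelC {w : ι → Fin 3 → ℂ} {d e : ℕ} (hd : d = e + 2) {Γ A : Finset ι} [DecidableEq ι]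
    (K : MvPolynomial (Fin 3) ℂ) (hK : K.IsHomogeneous 2)
    (hAW : ∀ i ∈ Γ, eval (w i) K = 0 → i ∈ A) (hAW' : ∀ i ∈ A, eval (w i) K = 0)
    (hA : Ind w d A) (hB : Ind w e (Γ \ A)) : Ind w d Γ := by
  refine residual K hK hd ?_ hA hB
  intro i hi
  by_cases hiA : i ∈ A
  · left; exact ⟨hAW' i hiA, hiA⟩
  · right
    exact ⟨fun h => hiA (hAW i hi h), by simp [hi, hiA]⟩

/-- a conic through at least `k+1` points, if `CB k` fails -/
lemma not_CB {w : ι → Fin 3 → ℂ} {Γ : Finset ι} {k : ℕ} (h : ¬ CB w Γ k) :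
    ∃ K : MvPolynomial (Fin 3) ℂ, K.IsHomogeneous 2 ∧ K ≠ 0 ∧ ∃ A ⊆ Γ,
      (∀ i ∈ Γ, eval (w i) K = 0 → i ∈ A) ∧ (∀ i ∈ A, eval (w i) K = 0) ∧ k + 1 ≤ A.card := by
  classical
  unfold CB at h
  push Not at h
  obtain ⟨K, hK, hK0, A, hA, hAK, hc⟩ := h
  refine ⟨K, hK, hK0, Γ.filter (fun i => eval (w i) K = 0), Finset.filter_subset _ _, ?_, ?_, ?_⟩
  · intro i hi h; simp [hi, h]
  · intro i hi; exact (Finset.mem_filter.1 hi).2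
  · refine hc.trans_le (Finset.card_le_card ?_)
    intro i hi; simp [hA hi, hAK i hi]

/-- a conic through five points of a set without six points on a conic -/
lemma five_conic {w : ι → Fin 3 → ℂ} {Γ : Finset ι} (h : CB w Γ 5) (h5 : 5 ≤ Γ.card) :
    ∃ K : MvPolynomial (Fin 3) ℂ, K.IsHomogeneous 2 ∧ K ≠ 0 ∧ ∃ A ⊆ Γ,
      (∀ i ∈ Γ, eval (w i) K = 0 → i ∈ A) ∧ (∀ i ∈ A, eval (w i) K = 0) ∧ A.card = 5 := by
  classical
  obtain ⟨A, hA, hA5⟩ := Finset.exists_subset_card_eq h5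
  obtain ⟨K, hK0, hK, hKA⟩ := exists_through (w := w) 2 A (by rw [hA5]; decide)
  refine ⟨K, hK, hK0, A, hA, ?_, hKA, hA5⟩
  intro i hi hi0
  by_contra hiA
  have := h K hK hK0 (insert i A) (by intro x; simp; rintro (rfl | h); exacts [hi, hA h])
    (by intro x; simp; rintro (rfl | h); exacts [hi0, hKA _ h])
  rw [Finset.card_insert_of_notMem hiA] at this
  omega

variable {w : ι → Fin 3 → ℂ}

lemma indJ6 (hw : PW w) {Γ : Finset ι} (hL : LB w Γ 2) (hC : CB w Γ 5) (h6 : Γ.card ≤ 6) :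
    Ind w 2 Γ := by
  classical
  by_cases h5 : Γ.card ≤ 5
  · exact indS hw 2 Γ (by omega) (hL.mono subset_rfl (by omega))
  intro p hp
  have hc : (Γ.erase p).card ≤ 5 := by rw [Finset.card_erase_of_mem hp]; omega
  obtain ⟨K, hK0, hK, hKA⟩ := exists_through (w := w) 2 (Γ.erase p)
    (lt_of_le_of_lt hc (by decide))
  refine ⟨K, hK, ?_, fun q hq hqp => hKA q (Finset.mem_erase.2 ⟨hqp, hq⟩)⟩
  intro h0
  have := hC K hK hK0 Γ subset_rfl (by
    intro i hi
    by_cases hip : i = p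
    · rw [hip]; exact h0
    · exact hKA i (Finset.mem_erase.2 ⟨hip, hi⟩))
  omega

lemma indN3 (hw : PW w) {Γ : Finset ι} (hL : LB w Γ 2) (hC : CB w Γ 6) (h8 : Γ.card ≤ 8) :
    Ind w 3 Γ := by
  classical
  by_cases h7 : Γ.card ≤ 7
  · exact indS hw 3 Γ (by omega) (hL.mono subset_rfl (by omega))
  by_cases h : CB w Γ 5
  · obtain ⟨K, hK, hK0, A, hA, h1, h2, h3⟩ := five_conic h (by omega)
    have hc := Finset.card_sdiff_add_card_eq_card hA
    exact peelC (e := 1) rfl K hK h1 h2 (indS hw 3 _ (by omega) (hL.mono hA (by omega)))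
      (indS hw 1 _ (by omega) (hL.mono Finset.sdiff_subset (by omega)))
  · obtain ⟨K, hK, hK0, A, hA, h1, h2, h3⟩ := not_CB h
    have hc := Finset.card_sdiff_add_card_eq_card hA
    have hA6 := hC K hK hK0 A hA h2
    exact peelC (e := 1) rfl K hK h1 h2 (indS hw 3 _ (by omega) (hL.mono hA (by omega)))
      (indT hw (by omega))

lemma indN4 (hw : PW w) {Γ : Finset ι} (hL : LB w Γ 2) (hC : CB w Γ 6) (h8 : Γ.card ≤ 11) :
    Ind w 4 Γ := by
  classical
  by_cases h7 : Γ.card ≤ 9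
  · exact indS hw 4 Γ (by omega) (hL.mono subset_rfl (by omega))
  by_cases h : CB w Γ 5
  · obtain ⟨K, hK, hK0, A, hA, h1, h2, h3⟩ := five_conic h (by omega)
    have hc := Finset.card_sdiff_add_card_eq_card hA
    exact peelC (e := 2) rfl K hK h1 h2 (indS hw 4 _ (by omega) (hL.mono hA (by omega)))
      (indJ6 hw (hL.mono Finset.sdiff_subset (by omega)) (h.mono Finset.sdiff_subset le_rfl)
        (by omega))
  · obtain ⟨K, hK, hK0, A, hA, h1, h2, h3⟩ := not_CB h
    have hc := Finset.card_sdiff_add_card_eq_card hA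
    have hA6 := hC K hK hK0 A hA h2
    exact peelC (e := 2) rfl K hK h1 h2 (indS hw 4 _ (by omega) (hL.mono hA (by omega)))
      (indS hw 2 _ (by omega) (hL.mono Finset.sdiff_subset (by omega)))

lemma two_vec {V : Type*} [AddCommGroup V] [Module ℂ V] (h : 2 ≤ Module.finrank ℂ V) :
    ∃ x y : V, ∀ a b : ℂ, a • x + b • y = 0 → a = 0 ∧ b = 0 := by
  obtain ⟨f, hf⟩ := exists_linearIndependent_of_le_finrank h
  have hf' : LinearIndependent ℂ ![f 0, f 1] := by
    convert hf using 1
    ext i; fin_cases i <;> rfl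
  exact ⟨f 0, f 1, LinearIndependent.pair_iff.1 hf'⟩

lemma exists_pair_cubics {A : Finset ι} (h : A.card ≤ 8) :
    ∃ Q₁ Q₂ : MvPolynomial (Fin 3) ℂ, Q₁.IsHomogeneous 3 ∧ Q₂.IsHomogeneous 3 ∧
      (∀ i ∈ A, eval (w i) Q₁ = 0) ∧ (∀ i ∈ A, eval (w i) Q₂ = 0) ∧
      ∀ a b : ℂ, a • Q₁ + b • Q₂ = 0 → a = 0 ∧ b = 0 := by
  have h1 := LinearMap.finrank_range_add_finrank_ker (evL w 3 A)
  have h2 := Submodule.finrank_le (LinearMap.range (evL w 3 A))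
  rw [Module.finrank_fintype_fun_eq_card, Fintype.card_coe] at h2
  rw [finrank_homog] at h1
  have hch : (3 + 2).choose 3 = 10 := by decide
  rw [hch] at h1
  have h3 : 2 ≤ Module.finrank ℂ (LinearMap.ker (evL w 3 A)) := by omega
  obtain ⟨x, y, hxy⟩ := two_vec (V := LinearMap.ker (evL w 3 A)) h3
  refine ⟨x.1.1, y.1.1, x.1.2, y.1.2,
    fun i hi => congrFun (LinearMap.mem_ker.1 x.2) ⟨i, hi⟩,
    fun i hi => congrFun (LinearMap.mem_ker.1 y.2) ⟨i, hi⟩, ?_⟩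
  intro a b hab
  exact hxy a b (Subtype.ext (Subtype.ext hab))

lemma quartic_syzygy {A : Finset ι} (h : A.card = 11) (hA : Ind w 4 A)
    {Q₁ Q₂ : MvPolynomial (Fin 3) ℂ} (h1 : Q₁.IsHomogeneous 3) (h2 : Q₂.IsHomogeneous 3)
    (hQ1 : ∀ i ∈ A, eval (w i) Q₁ = 0) (hQ2 : ∀ i ∈ A, eval (w i) Q₂ = 0) :
    ∃ L M : MvPolynomial (Fin 3) ℂ, L.IsHomogeneous 1 ∧ M.IsHomogeneous 1 ∧ (L ≠ 0 ∨ M ≠ 0) ∧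
      L * Q₁ + M * Q₂ = 0 := by
  classical
  have hsurj : Function.Surjective (evL w 4 A) := by
    choose! G hG1 hG2 hG3 using hA
    intro y
    refine ⟨∑ p : A, (y p / eval (w p) (G p)) • ⟨G p, hG1 p p.2⟩, ?_⟩
    rw [map_sum]
    ext q
    rw [Finset.sum_apply, Finset.sum_eq_single_of_mem q (Finset.mem_univ _)]
    · rw [map_smul]
      simp [evL, hG2 q q.2]
    · intro p _ hpq
      rw [map_smul]
      simp [evL, hG3 p p.2 q q.2 (fun h => hpq (Subtype.ext h.symm))]
  have r1 := LinearMap.finrank_range_add_finrank_ker (evL w 4 A)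
  have hch : (4 + 2).choose 4 = 15 := by decide
  have hch1 : (1 + 2).choose 1 = 3 := by decide
  rw [LinearMap.range_eq_top.2 hsurj, finrank_top, Module.finrank_fintype_fun_eq_card,
    Fintype.card_coe, finrank_homog, h, hch] at r1
  let S1 := homogeneousSubmodule (Fin 3) ℂ 1
  let Φ : (S1 × S1) →ₗ[ℂ] LinearMap.ker (evL w 4 A) :=
    { toFun := fun x => ⟨⟨x.1.1 * Q₁ + x.2.1 * Q₂,
        (IsHomogeneous.mul x.1.2 h1).add (IsHomogeneous.mul x.2.2 h2)⟩, by
          rw [LinearMap.mem_ker]; ext i; simp [evL, hQ1 i i.2, hQ2 i i.2]⟩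
      map_add' := fun x y => by
        ext1; ext1; simp; ring
      map_smul' := fun c x => by
        ext1; ext1; simp }
  have hni : ¬ Function.Injective Φ := by
    intro hi
    have := LinearMap.finrank_le_finrank_of_injective hi
    rw [Module.finrank_prod, finrank_homog, hch1] at this
    omega
  rw [injective_iff_map_eq_zero] at hni
  push Not at hni
  obtain ⟨⟨⟨L, hL⟩, ⟨M, hM⟩⟩, hx, hx0⟩ := hni
  refine ⟨L, M, hL, hM, ?_, ?_⟩
  · by_contra hcon
    push Not at hcon
    apply hx0
    ext1 <;> ext1 <;> simp [hcon.1, hcon.2]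
  · exact congrArg (fun z => z.1.1) hx

lemma hom_quot {Q M c : MvPolynomial (Fin 3) ℂ} (h1 : Q.IsHomogeneous 3)
    (hMh : M.IsHomogeneous 1) (hc : Q = M * c) : Q = M * homogeneousComponent 2 c := by
  have e : Q = ∑ i ∈ Finset.range (c.totalDegree + 1), M * homogeneousComponent i c := by
    rw [← Finset.mul_sum, sum_homogeneousComponent, hc]
  have e2 := congrArg (homogeneousComponent 3) e
  rw [homogeneousComponent_of_mem h1, if_pos rfl, map_sum] at e2
  have e3 : ∀ i, homogeneousComponent 3 (M * homogeneousComponent i c)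
      = if i = 2 then M * homogeneousComponent 2 c else 0 := by
    intro i
    rw [homogeneousComponent_of_mem (hMh.mul (homogeneousComponent_isHomogeneous i c))]
    by_cases h : i = 2
    · subst h; simp
    · rw [if_neg (by omega), if_neg h]
  rw [Finset.sum_congr rfl (fun i _ => e3 i), Finset.sum_ite_eq'] at e2
  split_ifs at e2 with h
  · exact e2
  · rw [homogeneousComponent_eq_zero 2 c (by simp at h; omega), mul_zero]
    exact e2

lemma syzygy_contra {Γ : Finset ι} (hL : LB w Γ 2) (hC : CB w Γ 6) (h14 : Γ.card = 14)
    {Q₁ Q₂ L M : MvPolynomial (Fin 3) ℂ} (h1 : Q₁.IsHomogeneous 3)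
    (hQ1 : ∀ i ∈ Γ, eval (w i) Q₁ = 0)
    (hli : ∀ a b : ℂ, a • Q₁ + b • Q₂ = 0 → a = 0 ∧ b = 0)
    (hLh : L.IsHomogeneous 1) (hMh : M.IsHomogeneous 1) (hLM : L ≠ 0 ∨ M ≠ 0)
    (hs : L * Q₁ + M * Q₂ = 0) : False := by
  classical
  have hQ10 : Q₁ ≠ 0 := by
    rintro rfl
    exact one_ne_zero (hli 1 0 (by simp)).1
  have hM0 : M ≠ 0 := by
    rintro rfl
    simp [hQ10] at hs
    simp [hs] at hLM
  have hirr : Irreducible M := by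
    apply irreducible_of_totalDegree_eq_one (hMh.totalDegree hM0)
    intro x hx
    rw [isUnit_iff_ne_zero]
    rintro rfl
    apply hM0
    ext i
    simpa using hx i
  have hprime : Prime M := hirr.prime
  have hdvd : M ∣ L * Q₁ := ⟨-Q₂, by linear_combination hs⟩
  rcases hprime.dvd_or_dvd hdvd with ⟨c, hc⟩ | ⟨c, hc⟩
  · have hcC : ∃ r : ℂ, c = C r := by
      by_cases hL0 : L = 0
      · refine ⟨0, ?_⟩
        rw [hL0] at hc
        have := (mul_eq_zero.1 hc.symm).resolve_left hM0
        simp [this]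
      · have hc0 : c ≠ 0 := by rintro rfl; simp at hc; exact hL0 hc
        have := totalDegree_mul_of_isDomain hM0 hc0
        rw [← hc, hLh.totalDegree hL0, hMh.totalDegree hM0] at this
        exact ⟨_, totalDegree_eq_zero_iff_eq_C.1 (by omega)⟩
    obtain ⟨r, rfl⟩ := hcC
    have : M * (r • Q₁ + (1 : ℂ) • Q₂) = 0 := by
      rw [hc] at hs
      rw [MvPolynomial.smul_eq_C_mul, one_smul]
      linear_combination hs
    have := (mul_eq_zero.1 this).resolve_left hM0
    exact one_ne_zero (hli _ _ this).2
  · have hQc : Q₁ = M * homogeneousComponent 2 c := hom_quot h1 hMh hc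
    obtain ⟨K, hKdef⟩ : ∃ K, K = homogeneousComponent 2 c := ⟨_, rfl⟩
    have hK : K.IsHomogeneous 2 := hKdef ▸ homogeneousComponent_isHomogeneous _ _
    rw [← hKdef] at hQc
    have hK0 : K ≠ 0 := by rintro rfl; simp at hQc; exact hQ10 hQc
    have hlin : ∃ f : (Fin 3 → ℂ) →ₗ[ℂ] ℂ, ∀ x, eval x M = f x := exists_lin hMh
    obtain ⟨f, hf⟩ := hlin
    have hf0 : f ≠ 0 := by
      rintro rfl; exact hM0 (MvPolynomial.funext fun x => by simp [hf])
    have e1 := hL (LinearMap.ker f) (finrank_ker_le hf0).le (Γ.filter fun i => f (w i) = 0)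
      (Finset.filter_subset _ _) (by simp)
    have e2 := hC K hK hK0 (Γ.filter fun i => ¬ f (w i) = 0) (Finset.filter_subset _ _) (by
      intro i hi
      rw [Finset.mem_filter] at hi
      have := hQ1 i hi.1
      rw [hQc, map_mul, hf] at this
      exact (mul_eq_zero.1 this).resolve_left hi.2)
    have := Finset.card_filter_add_card_filter_not (s := Γ) (fun i => f (w i) = 0)
    omega

lemma indN5 (hw : PW w) {Γ : Finset ι} (hL : LB w Γ 2) (hC : CB w Γ 6) (h14 : Γ.card ≤ 14) :
    Ind w 5 Γ := by
  classical
  by_cases h : CB w Γ 5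
  swap
  · obtain ⟨K, hK, hK0, A, hA, h1, h2, h3⟩ := not_CB h
    have hc := Finset.card_sdiff_add_card_eq_card hA
    have hA6 := hC K hK hK0 A hA h2
    exact peelC (e := 3) rfl K hK h1 h2 (indS hw 5 _ (by omega) (hL.mono hA (by omega)))
      (indN3 hw (hL.mono Finset.sdiff_subset (by omega)) (hC.mono Finset.sdiff_subset le_rfl)
        (by omega))
  by_cases h7 : Γ.card ≤ 11
  · exact indS hw 5 Γ (by omega) (hL.mono subset_rfl (by omega))
  by_cases h13 : Γ.card ≤ 13
  · obtain ⟨K, hK, hK0, A, hA, h1, h2, h3⟩ := five_conic h (by omega)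
    have hc := Finset.card_sdiff_add_card_eq_card hA
    exact peelC (e := 3) rfl K hK h1 h2 (indS hw 5 _ (by omega) (hL.mono hA (by omega)))
      (indN3 hw (hL.mono Finset.sdiff_subset (by omega)) (hC.mono Finset.sdiff_subset le_rfl)
        (by omega))
  have hcard : Γ.card = 14 := by omega
  intro p hp
  by_contra hcon
  push Not at hcon
  have hbad : ∀ G : MvPolynomial (Fin 3) ℂ, G.IsHomogeneous 5 →
      (∀ q ∈ Γ, q ≠ p → eval (w q) G = 0) → eval (w p) G = 0 := by
    intro G hG h0
    by_contra hne
    obtain ⟨q, hq, hqp, hq0⟩ := hcon G hG hne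
    exact hq0 (h0 q hq hqp)
  -- the thirteen other points
  have hT : (Γ.erase p).card = 13 := by rw [Finset.card_erase_of_mem hp]; omega
  obtain ⟨B, hB, hB7⟩ := Finset.exists_subset_card_eq (show 7 ≤ (Γ.erase p).card by omega)
  obtain ⟨B5, hB5, hB5c⟩ := Finset.exists_subset_card_eq (show 5 ≤ B.card by omega)
  have conicSep : ∀ Y ⊆ Γ.erase p, Y.card = 5 → ∃ K : MvPolynomial (Fin 3) ℂ,
      K.IsHomogeneous 2 ∧ eval (w p) K ≠ 0 ∧ ∀ q ∈ Y, eval (w q) K = 0 := by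
    intro Y hY hY5
    have hpY : p ∉ Y := fun h => by simpa using hY h
    have hs : insert p Y ⊆ Γ := by
      intro x hx
      rcases Finset.mem_insert.1 hx with rfl | hx
      · exact hp
      · exact Finset.mem_of_mem_erase (hY hx)
    obtain ⟨K, k1, k2, k3⟩ := indJ6 hw (hL.mono hs le_rfl) (h.mono hs le_rfl)
      (by rw [Finset.card_insert_of_notMem hpY]; omega) p (Finset.mem_insert_self _ _)
    exact ⟨K, k1, k2, fun q hq => k3 q (Finset.mem_insert_of_mem hq) (fun e => hpY (e ▸ hq))⟩
  -- a cubic through `B` not through `p`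
  obtain ⟨c0, hc0, hc0p, hc0B⟩ : ∃ c0 : MvPolynomial (Fin 3) ℂ, c0.IsHomogeneous 3 ∧
      eval (w p) c0 ≠ 0 ∧ ∀ q ∈ B, eval (w q) c0 = 0 := by
    obtain ⟨K, k1, k2, k3⟩ := conicSep B5 (hB5.trans hB) hB5c
    have hcc := Finset.card_sdiff_add_card_eq_card hB5
    have hpY : p ∉ B \ B5 := fun h => by simpa using hB (Finset.sdiff_subset h)
    have hs : insert p (B \ B5) ⊆ Γ := by
      intro x hx
      rcases Finset.mem_insert.1 hx with rfl | hx
      · exact hp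
      · exact Finset.mem_of_mem_erase (hB (Finset.sdiff_subset hx))
    obtain ⟨L, l1, l2, l3⟩ := indS hw 1 (insert p (B \ B5))
      (by rw [Finset.card_insert_of_notMem hpY]; omega) (hL.mono hs le_rfl) p
      (Finset.mem_insert_self _ _)
    refine ⟨K * L, k1.mul l1, by simp [k2, l2], fun q hq => ?_⟩
    by_cases hq5 : q ∈ B5
    · simp [k3 q hq5]
    · have : q ∈ B \ B5 := by simp [hq, hq5]
      simp [l3 q (Finset.mem_insert_of_mem this) (fun e => hpY (e ▸ this))]
  -- cubics through eight of the thirteen points pass through `p`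
  have eight : ∀ t ∈ Γ.erase p, t ∉ B → ∀ Q : MvPolynomial (Fin 3) ℂ, Q.IsHomogeneous 3 →
      (∀ q ∈ B, eval (w q) Q = 0) → eval (w t) Q = 0 → eval (w p) Q = 0 := by
    intro t ht htB Q hQ hQB hQt
    have hs : insert t B ⊆ Γ.erase p := by
      intro x hx
      rcases Finset.mem_insert.1 hx with rfl | hx
      · exact ht
      · exact hB hx
    have hcc := Finset.card_sdiff_add_card_eq_card hs
    rw [Finset.card_insert_of_notMem htB] at hcc
    obtain ⟨K, k1, k2, k3⟩ := conicSep (Γ.erase p \ insert t B) Finset.sdiff_subset (by omega)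
    have := hbad (Q * K) (hQ.mul k1) (by
      intro q hq hqp
      by_cases hqB : q ∈ insert t B
      · rcases Finset.mem_insert.1 hqB with rfl | hqB
        · simp [hQt]
        · simp [hQB q hqB]
      · have : q ∈ Γ.erase p \ insert t B :=
          Finset.mem_sdiff.2 ⟨Finset.mem_erase.2 ⟨hqp, hq⟩, hqB⟩
        simp [k3 q this])
    rw [map_mul] at this
    exact (mul_eq_zero.1 this).resolve_right k2
  have all : ∀ Q : MvPolynomial (Fin 3) ℂ, Q.IsHomogeneous 3 →
      (∀ q ∈ insert p B, eval (w q) Q = 0) → ∀ q ∈ Γ, eval (w q) Q = 0 := by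
    intro Q hQ hQB t ht
    by_cases htB : t ∈ insert p B
    · exact hQB t htB
    rw [Finset.mem_insert, not_or] at htB
    have hQp := hQB p (Finset.mem_insert_self _ _)
    have := eight t (Finset.mem_erase.2 ⟨htB.1, ht⟩) htB.2
      (C (eval (w t) c0) * Q - C (eval (w t) Q) * c0) ((hQ.C_mul _).sub (hc0.C_mul _))
      (by intro q hq; simp [hc0B q hq, hQB q (Finset.mem_insert_of_mem hq)])
      (by simp; ring)
    simpa [hQp, hc0p] using this
  obtain ⟨Q₁, Q₂, h1, h2, hQ1, hQ2, hli⟩ := exists_pair_cubics (w := w) (A := insert p B)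
    ((Finset.card_insert_le _ _).trans (by omega))
  obtain ⟨A, hA, hA11⟩ := Finset.exists_subset_card_eq (show 11 ≤ Γ.card by omega)
  obtain ⟨L, M, hLh, hMh, hLM, hs⟩ := quartic_syzygy hA11
    (indN4 hw (hL.mono hA le_rfl) (hC.mono hA le_rfl) hA11.le) h1 h2
    (fun i hi => all Q₁ h1 hQ1 i (hA hi)) (fun i hi => all Q₂ h2 hQ2 i (hA hi))
  exact syzygy_contra hL hC hcard h1 (all Q₁ h1 hQ1) hli hLh hMh hLM hs

/-- no three collinear -/
lemma indN (hw : PW w) (d : ℕ) (h2 : 2 ≤ d) (h5 : d ≤ 5) {Γ : Finset ι} (hL : LB w Γ 2)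
    (hC : CB w Γ 6) (h : Γ.card ≤ 3 * d - 1) : Ind w d Γ := by
  interval_cases d
  · exact indS hw 2 _ (by omega) (hL.mono subset_rfl (by omega))
  · exact indN3 hw hL hC h
  · exact indN4 hw hL hC h
  · exact indN5 hw hL hC h

/-- at most six points of every subset without collinear triples lie on a conic -/
def CB' {ι : Type*} (w : ι → Fin 3 → ℂ) (Γ : Finset ι) (k : ℕ) : Prop :=
  ∀ A ⊆ Γ, LB w A 2 → CB w A k

lemma indQ (hw : PW w) (d : ℕ) (h2 : 2 ≤ d) : ∀ (_ : d ≤ 5) (Γ : Finset ι), LB w Γ 3 →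
    CB' w Γ 6 → Γ.card ≤ 3 * d - 1 → Ind w d Γ := by
  classical
  induction d, h2 using Nat.le_induction with
  | base => intro _ Γ hL _ h; exact indS hw 2 _ (by omega) hL
  | succ d h2 ih =>
    intro h5 Γ hL hC h
    obtain ⟨W, hW, A, hA, hAW, hAW', hm⟩ := exists_max_line w Γ
    by_cases hA2 : A.card ≤ 2
    · have hL2 := hm.mono subset_rfl hA2
      exact indN hw (d + 1) (by omega) h5 hL2 (hC Γ subset_rfl hL2) h
    · have hc := Finset.card_sdiff_add_card_eq_card hA
      have hA3 := hL W hW A hA hAW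
      exact peel rfl W hAW' hAW (indT hw (by omega)) (ih (by omega) _
        (hL.mono Finset.sdiff_subset le_rfl) (fun A' hA' => hC A' (hA'.trans Finset.sdiff_subset))
        (by omega))

/-- the plane theorem -/
lemma plane5 (hw : PW w) {Γ : Finset ι} (h14 : Γ.card ≤ 14) (hL : LB w Γ 5)
    (hC : CB' w Γ 11) : Ind w 5 Γ := by
  classical
  obtain ⟨W, hW, A, hA, hAW, hAW', hm⟩ := exists_max_line w Γ
  have hc := Finset.card_sdiff_add_card_eq_card hA
  have hA5 := hL W hW A hA hAW
  by_cases h5 : 5 ≤ A.card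
  · exact peel (e := 4) rfl W hAW' hAW (indT hw (by omega))
      (indS hw 4 _ (by omega) (hL.mono Finset.sdiff_subset le_rfl))
  have hL4 : LB w Γ 4 := hm.mono subset_rfl (by omega)
  by_cases hC6 : CB' w Γ 6
  swap
  · unfold CB' at hC6
    push Not at hC6
    obtain ⟨D, hD, hDL, hDC⟩ := hC6
    obtain ⟨K, hK, hK0, E, hE, h1, h2, h3⟩ := not_CB hDC
    have hN : LB w (Γ.filter fun i => eval (w i) K = 0) 2 :=
      conic_ntc hw hK hK0 (hDL.mono hE le_rfl) h2 (by omega) (by simp)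
    have h11 := hC _ (Finset.filter_subset _ _) hN K hK hK0 _ subset_rfl (by simp)
    have hEc : E.card ≤ (Γ.filter fun i => eval (w i) K = 0).card := by
      apply Finset.card_le_card
      intro i hi
      simp [hD (hE hi), h2 i hi]
    have hcc := Finset.card_sdiff_add_card_eq_card
      (Finset.filter_subset (fun i => eval (w i) K = 0) Γ)
    exact peelC (e := 3) rfl K hK (by intro i hi h; simp [hi, h]) (by simp)
      (indS hw 5 _ h11 (hN.mono subset_rfl (by omega)))
      (indS hw 3 _ (by omega) (hL4.mono Finset.sdiff_subset le_rfl))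
  by_cases h4 : 4 ≤ A.card
  · refine peel (e := 4) rfl W hAW' hAW (indT hw (by omega)) ?_
    obtain ⟨W2, hW2, A2, hA2, hAW2, hAW2', hm2⟩ := exists_max_line w (Γ \ A)
    have hc2 := Finset.card_sdiff_add_card_eq_card hA2
    have hA24 := hL4 W2 hW2 A2 (hA2.trans Finset.sdiff_subset) hAW2
    by_cases h3 : 3 ≤ A2.card
    · exact peel (e := 3) rfl W2 hAW2' hAW2 (indT hw (by omega))
        (indS hw 3 _ (by omega) (hL4.mono (Finset.sdiff_subset.trans Finset.sdiff_subset) le_rfl))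
    · have hN := hm2.mono subset_rfl (show A2.card ≤ 2 by omega)
      exact indN4 hw hN (hC6 _ Finset.sdiff_subset hN) (by omega)
  · exact indQ hw 5 (by omega) le_rfl Γ (hm.mono subset_rfl (by omega)) hC6 (by omega)

/-- the common zeros of the forms `D j` contain no infinite family of distinct points -/
def NC (D : Fin 4 → MvPolynomial (Fin 4) ℂ) : Prop :=
  ∀ (u : ℂ → Fin 4 → ℂ) (T : Set ℂ), T.Infinite → (∀ t ∈ T, u t ≠ 0) →
    (∀ s ∈ T, ∀ t ∈ T, s ≠ t → u s ∉ Submodule.span ℂ {u t}) →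
    ¬ ∀ t ∈ T, ∀ j, eval (u t) (D j) = 0

lemma line5 {v : ι → Fin 4 → ℂ} (hv : PW v) {D : Fin 4 → MvPolynomial (Fin 4) ℂ}
    (hD : ∀ j, (D j).IsHomogeneous 5) (hvD : ∀ i j, eval (v i) (D j) = 0) (hN : NC D)
    (Γ : Finset ι) : LB v Γ 5 := by
  classical
  intro W hW A _ hAW
  by_contra hcon
  obtain ⟨f, -, hf⟩ := generic (v := v) ⊥ A (by intro i _; simpa using hv.1 i)
  obtain ⟨i, hi, j, hj, hij⟩ := Finset.one_lt_card.1 (show 1 < A.card by omega)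
  set a := v i with ha
  obtain ⟨b, hb⟩ : ∃ b, b = f (v j) • v i - f (v i) • v j := ⟨_, rfl⟩
  have hfb : f b = 0 := by rw [hb, map_sub, map_smul, map_smul, smul_eq_mul, smul_eq_mul]; ring
  have hbW : b ∈ W := by
    rw [hb]
    exact W.sub_mem (W.smul_mem _ (hAW i hi)) (W.smul_mem _ (hAW j hj))
  have hb0 : b ≠ 0 := by
    intro h0
    apply hv.2 i j hij
    rw [Submodule.mem_span_singleton]
    refine ⟨(f (v j))⁻¹ * f (v i), ?_⟩
    rw [hb, sub_eq_zero] at h0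
    rw [mul_smul, ← h0, smul_smul, inv_mul_cancel₀ (hf j hj), one_smul]
  have hlt : W ⊓ LinearMap.ker f < W := by
    refine lt_of_le_of_ne inf_le_left fun h => ?_
    have := h.ge (hAW i hi)
    exact hf i hi this.2
  have hU := Submodule.finrank_lt_finrank_of_lt hlt
  let b' : ↥(W ⊓ LinearMap.ker f) := ⟨b, hbW, hfb⟩
  have hb'0 : b' ≠ 0 := fun h => hb0 (congrArg Subtype.val h)
  have hpos : 0 < Module.finrank ℂ ↥(W ⊓ LinearMap.ker f) :=
    Module.finrank_pos_iff_exists_ne_zero.2 ⟨b', hb'0⟩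
  have hone := (finrank_eq_one_iff_of_nonzero' b' hb'0).1
    (le_antisymm (Nat.le_of_lt_succ (hU.trans_le hW)) hpos)
  have hfa : f a ≠ 0 := hf i hi
  have key : ∀ q ∈ A, ∃ t : ℂ, v q = (f (v q) / f a) • (a + t • b) := by
    intro q hq
    obtain ⟨c, hc⟩ := hone ⟨(f a / f (v q)) • v q - a,
      W.sub_mem (W.smul_mem _ (hAW q hq)) (hAW i hi), by
        have := hf q hq
        change f _ = 0
        rw [map_sub, map_smul, smul_eq_mul]
        field_simp; ring⟩
    have hc' : c • b = (f a / f (v q)) • v q - a := congrArg Subtype.val hc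
    refine ⟨c, ?_⟩
    rw [hc', add_sub_cancel, smul_smul]
    have := hf q hq
    rw [show f (v q) / f a * (f a / f (v q)) = 1 by field_simp, one_smul]
  choose! t ht using key
  have hinj : Set.InjOn t A := by
    intro q hq r hr hqr
    by_contra hne
    apply hv.2 q r hne
    rw [Submodule.mem_span_singleton]
    refine ⟨(f (v q) / f a) * (f a / f (v r)), ?_⟩
    have h1 := hf r hr
    nth_rewrite 2 [ht r hr]
    conv_rhs => rw [ht q hq, hqr]
    rw [smul_smul]
    congr 1
    field_simp
  have hcard : (A.image t).card = A.card := Finset.card_image_of_injOn hinj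
  have hu : ∀ s : ℂ, (fun k => (Polynomial.C (a k) + Polynomial.C (b k) * Polynomial.X).eval s)
      = a + s • b := by
    intro s; ext k; simp; ring
  apply hN (fun s => a + s • b) Set.univ Set.infinite_univ
  · intro s _ h0
    have := congrArg f h0
    simp [hfb, hfa] at this
  · intro s _ r _ hsr hm
    rw [Submodule.mem_span_singleton] at hm
    obtain ⟨c, hc⟩ := hm
    have h1 := congrArg f hc
    simp [hfb, hfa] at h1
    rw [h1, one_smul, add_right_inj, ← sub_eq_zero, ← sub_smul, smul_eq_zero] at hc
    rcases hc with hc | hc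
    · exact hsr (sub_eq_zero.1 hc).symm
    · exact hb0 hc
  · intro s _ k
    have := param_vanish (m := 1) (hD k)
      (fun k => Polynomial.C (a k) + Polynomial.C (b k) * Polynomial.X) (by
        intro k; compute_degree) (A.image t) (by omega) (by
        intro r hr
        rw [Finset.mem_image] at hr
        obtain ⟨q, hq, rfl⟩ := hr
        rw [hu]
        have h1 := hvD q k
        rw [ht q hq, eval_smul' (hD k)] at h1
        exact (mul_eq_zero.1 h1).resolve_left (pow_ne_zero _ (div_ne_zero (hf q hq) hfa))) s
    rwa [hu] at this

lemma pull {m n d : ℕ} (φ : (Fin m → ℂ) →ₗ[ℂ] (Fin n → ℂ)) {G : MvPolynomial (Fin n) ℂ}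
    (hG : G.IsHomogeneous d) :
    ∃ G' : MvPolynomial (Fin m) ℂ, G'.IsHomogeneous d ∧ ∀ x, eval x G' = eval (φ x) G := by
  choose L hL1 hL2 using fun i : Fin n => exists_form ((LinearMap.proj i).comp φ)
  refine ⟨aeval L G, ?_, ?_⟩
  · simpa using hG.aeval L hL1
  · intro x
    have := MvPolynomial.eval₂_comp_left (eval x) (algebraMap ℂ (MvPolynomial (Fin m) ℂ)) L G
    rw [MvPolynomial.aeval_def, this]
    have h2 : (eval x).comp (algebraMap ℂ (MvPolynomial (Fin m) ℂ)) = RingHom.id ℂ := by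
      ext; simp
    rw [h2]
    have h3 : (⇑(eval x) ∘ L) = φ x := by
      ext i; simp [hL2]
    rw [h3]; rfl

lemma planeInd {v : ι → Fin 4 → ℂ} (hv : PW v) {D : Fin 4 → MvPolynomial (Fin 4) ℂ}
    (hD : ∀ j, (D j).IsHomogeneous 5) (hvD : ∀ i j, eval (v i) (D j) = 0) (hN : NC D)
    {f : (Fin 4 → ℂ) →ₗ[ℂ] ℂ} (hf : f ≠ 0) {Γ : Finset ι} (hΓ : ∀ i ∈ Γ, f (v i) = 0)
    (h14 : Γ.card ≤ 14) : Ind v 5 Γ := by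
  classical
  have hfr : Module.finrank ℂ (Fin 3 → ℂ) = Module.finrank ℂ (LinearMap.ker f) := by
    have := Module.Dual.finrank_ker_add_one_of_ne_zero (K := ℂ) (f := f) hf
    simp at this ⊢
    omega
  let e := LinearEquiv.ofFinrankEq _ _ hfr
  obtain ⟨φ, hφ⟩ : ∃ φ : (Fin 3 → ℂ) →ₗ[ℂ] (Fin 4 → ℂ), φ = (LinearMap.ker f).subtype ∘ₗ e.toLinearMap :=
    ⟨_, rfl⟩
  have hφi : Function.Injective φ := by
    rw [hφ]; exact Subtype.val_injective.comp e.injective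
  obtain ⟨ψ, hψ⟩ := LinearMap.exists_leftInverse_of_injective φ (LinearMap.ker_eq_bot.2 hφi)
  have hψ' : ∀ x, ψ (φ x) = x := fun x => LinearMap.congr_fun hψ x
  have hφψ : ∀ i ∈ Γ, φ (ψ (v i)) = v i := by
    intro i hi
    have : v i = φ (e.symm ⟨v i, hΓ i hi⟩) := by simp [hφ]
    rw [this, hψ']
  have hsp : ∀ x y, φ x ∈ Submodule.span ℂ {φ y} → x ∈ Submodule.span ℂ {y} := by
    intro x y h
    rw [Submodule.mem_span_singleton] at h ⊢
    obtain ⟨c, hc⟩ := h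
    exact ⟨c, hφi (by rw [map_smul, hc])⟩
  have hsp' : ∀ x y, x ∈ Submodule.span ℂ {y} → φ x ∈ Submodule.span ℂ {φ y} := by
    intro x y h
    rw [Submodule.mem_span_singleton] at h ⊢
    obtain ⟨c, hc⟩ := h
    exact ⟨c, by rw [← map_smul, hc]⟩
  let w : Γ → Fin 3 → ℂ := fun i => ψ (v i)
  have hφw : ∀ i : Γ, φ (w i) = v i := fun i => hφψ i i.2
  have hw : PW w := by
    constructor
    · intro i h0
      apply hv.1 i
      rw [← hφw, h0, map_zero]
    · intro i j hij hm
      apply hv.2 i j (fun h => hij (Subtype.ext h))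
      rw [← hφw, ← hφw]
      exact hsp' _ _ hm
  have hL : LB w Finset.univ 5 := by
    intro W hW A _ hAW
    have := line5 hv hD hvD hN Γ (W.map φ) ((Submodule.finrank_map_le _ _).trans hW)
      (A.map (Function.Embedding.subtype _)) (by
        intro i hi; simp at hi; exact hi.1) (by
        intro i hi
        simp at hi
        obtain ⟨h1, h2⟩ := hi
        exact ⟨w ⟨i, h1⟩, hAW _ h2, hφw ⟨i, h1⟩⟩)
    simpa using this
  have hC : CB' w Finset.univ 11 := by
    intro A _ hA2 K hK hK0 B hB hBK
    by_contra hcon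
    obtain ⟨u, T, hT, hu0, hup, hG⟩ := conic_param hw hK hK0 (hA2.mono hB le_rfl) hBK (by omega)
    refine hN (fun t => φ (u t)) T hT ?_ ?_ ?_
    · intro t ht h0
      exact hu0 t ht (hφi (by rw [h0, map_zero]))
    · intro s hs t ht hst hm
      exact hup s hs t ht hst (hsp _ _ hm)
    · intro t _ j
      obtain ⟨G, hG1, hG2⟩ := pull φ (hD j)
      rw [← hG2]
      refine hG G hG1 ?_ t
      intro i _
      rw [hG2, hφw, hvD]
  have hI := plane5 hw (Γ := Finset.univ) (by simpa using h14) hL hC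
  intro p hp
  obtain ⟨G, hG1, hG2, hG3⟩ := hI ⟨p, hp⟩ (Finset.mem_univ _)
  obtain ⟨G', h1, h2⟩ := pull ψ hG1
  refine ⟨G', h1, by rw [h2]; exact hG2, ?_⟩
  intro q hq hqp
  rw [h2]
  exact hG3 ⟨q, hq⟩ (Finset.mem_univ _) (fun h => hqp (congrArg Subtype.val h))

lemma exists_functional {S : Submodule ℂ (Fin 4 → ℂ)} (h : Module.finrank ℂ S ≤ 3) :
    ∃ f : (Fin 4 → ℂ) →ₗ[ℂ] ℂ, f ≠ 0 ∧ ∀ x ∈ S, f x = 0 := by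
  have : S < ⊤ := by
    rw [lt_top_iff_ne_top]
    rintro rfl
    simp at h
  obtain ⟨f, h1, h2⟩ := Submodule.exists_le_ker_of_lt_top S this
  exact ⟨f, h1, fun x hx => h2 hx⟩

/-- every plane contains at most `k` points -/
def PB {ι : Type*} (v : ι → Fin 4 → ℂ) (Γ : Finset ι) (k : ℕ) : Prop :=
  ∀ f : (Fin 4 → ℂ) →ₗ[ℂ] ℂ, f ≠ 0 → ∀ A ⊆ Γ, (∀ i ∈ A, f (v i) = 0) → A.card ≤ k

lemma small {v : ι → Fin 4 → ℂ} (hv : PW v) (e : ℕ) : ∀ Γ : Finset ι, PB v Γ 4 → LB v Γ 3 →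
    Γ.card ≤ 3 * e + 5 → Ind v (e + 2) Γ := by
  classical
  induction e with
  | zero => intro Γ _ hL h; exact indS hv 2 Γ (by omega) hL
  | succ e ih =>
    intro Γ hP hL h
    by_cases h3 : Γ.card ≤ 3
    · exact indT hv (by omega)
    obtain ⟨i, j, k, hi, hj, hk, hij, hik, hjk⟩ := Finset.two_lt_card_iff.1
      (show 2 < Γ.card by omega)
    obtain ⟨f, hf0, hf⟩ := exists_functional
      (S := Submodule.span ℂ {v i, v j} ⊔ Submodule.span ℂ {v k}) (by
        have h1 := Submodule.finrank_add_le_finrank_add_finrank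
          (Submodule.span ℂ {v i, v j}) (Submodule.span ℂ {v k})
        have h2 := finrank_pair (v i) (v j)
        have h3 := finrank_span_singleton (K := ℂ) (hv.1 k)
        omega)
    obtain ⟨A, hA⟩ : ∃ A, A = Γ.filter (fun i => f (v i) = 0) := ⟨_, rfl⟩
    have hAs : A ⊆ Γ := hA ▸ Finset.filter_subset _ _
    have hA4 : A.card ≤ 4 := hP f hf0 A hAs (by simp [hA])
    have hA3 : 3 ≤ A.card := by
      have : ({i, j, k} : Finset ι) ⊆ A := by
        intro x hx
        have h1 : f (v i) = 0 := hf _ (Submodule.mem_sup_left (Submodule.subset_span (by simp)))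
        have h2 : f (v j) = 0 := hf _ (Submodule.mem_sup_left (Submodule.subset_span (by simp)))
        have h3 : f (v k) = 0 := hf _ (Submodule.mem_sup_right (Submodule.subset_span (by simp)))
        simp at hx
        rcases hx with rfl | rfl | rfl <;> simp [hA, *]
      have h1 := Finset.card_le_card this
      rwa [Finset.card_eq_three.2 ⟨i, j, k, hij, hik, hjk, rfl⟩] at h1
    have hc := Finset.card_sdiff_add_card_eq_card hAs
    refine peel (e := e + 2) (A := A) rfl (LinearMap.ker f) ?_ ?_ (indT hv (by omega)) (ih _ ?_ ?_ (by omega))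
    · intro i hi hi'
      have : f (v i) = 0 := hi'
      simp [hA, hi, this]
    · intro i hi
      simp [hA] at hi
      exact hi.2
    · exact fun f hf B hB => hP f hf B (hB.trans Finset.sdiff_subset)
    · exact hL.mono Finset.sdiff_subset le_rfl

lemma main_ind {v : ι → Fin 4 → ℂ} (hv : PW v) {D : Fin 4 → MvPolynomial (Fin 4) ℂ}
    (hD : ∀ j, (D j).IsHomogeneous 5) (hvD : ∀ i j, eval (v i) (D j) = 0) (hN : NC D)
    {Γ : Finset ι} (h14 : Γ.card ≤ 14) : Ind v 5 Γ := by
  classical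
  have hL5 := line5 hv hD hvD hN Γ
  by_cases hP : PB v Γ 4
  swap
  · unfold PB at hP
    push Not at hP
    obtain ⟨f, hf0, B, hB, hBf, hB5⟩ := hP
    obtain ⟨A, hA⟩ : ∃ A, A = Γ.filter (fun i => f (v i) = 0) := ⟨_, rfl⟩
    have hAs : A ⊆ Γ := hA ▸ Finset.filter_subset _ _
    have hBA : B.card ≤ A.card := Finset.card_le_card (by
      intro i hi; simp [hA, hB hi, hBf i hi])
    have hc := Finset.card_sdiff_add_card_eq_card hAs
    refine peel (e := 4) (A := A) rfl (LinearMap.ker f) ?_ ?_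
      (planeInd hv hD hvD hN hf0 (Γ := A) (by simp [hA]) (by omega))
      (indS hv 4 _ (by omega) (hL5.mono Finset.sdiff_subset le_rfl))
    · intro i hi hi'
      have : f (v i) = 0 := hi'
      simp [hA, hi, this]
    · intro i hi
      simp [hA] at hi
      exact hi.2
  by_cases h6 : Γ.card ≤ 6
  · exact indT hv h6
  refine small hv 3 Γ hP ?_ h14
  intro W hW A hA hAW
  by_contra hcon
  obtain ⟨c, hc, hcA⟩ : ∃ c ∈ Γ, 5 ≤ (insert c A).card := by
    by_cases hAe : A = Γ
    · obtain ⟨c, hc⟩ := Finset.card_pos.1 (show 0 < Γ.card by omega)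
      exact ⟨c, hc, by rw [hAe, Finset.insert_eq_of_mem hc]; omega⟩
    · obtain ⟨c, hc, hcA⟩ := Finset.exists_of_ssubset (hA.ssubset_of_ne hAe)
      exact ⟨c, hc, by rw [Finset.card_insert_of_notMem hcA]; omega⟩
  obtain ⟨f, hf0, hf⟩ := exists_functional (S := W ⊔ Submodule.span ℂ {v c}) (by
    have h1 := Submodule.finrank_add_le_finrank_add_finrank W (Submodule.span ℂ {v c})
    have h3 := finrank_span_singleton (K := ℂ) (hv.1 c)
    omega)
  have := hP f hf0 (insert c A) (Finset.insert_subset hc hA) (by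
    intro i hi
    rw [Finset.mem_insert] at hi
    rcases hi with rfl | hi
    · exact hf _ (Submodule.mem_sup_right (Submodule.subset_span (by simp)))
    · exact hf _ (Submodule.mem_sup_left (hAW i hi)))
  omega

end SexticNodes

/-- If the singular locus `Σ` of a sextic surface `S = Z(F) ⊂ ℙ³`
is finite, consists only of simple double points, and `#Σ ≤ 14`, then `Σ` imposes
independent conditions on quintics: for every singular point `p` there is a
homogeneous quintic vanishing at all the other singular points and not at `p`. -/
theorem stmt0 (F : MvPolynomial (Fin 4) ℂ) (hF : F.IsHomogeneous 6)
    (hfin : {p : ProjP3 | IsSingularPt F p}.Finite)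
    (hnode : ∀ p : ProjP3, IsSingularPt F p → IsNodePt F p)
    (hcard : {p : ProjP3 | IsSingularPt F p}.ncard ≤ 14) :
    ∀ p : ProjP3, IsSingularPt F p →
      ∃ G : MvPolynomial (Fin 4) ℂ, G.IsHomogeneous 5 ∧
        (∀ q : ProjP3, IsSingularPt F q → q ≠ p → eval q.rep G = 0) ∧
        eval p.rep G ≠ 0 := by
  classical
  have hD : ∀ j, (pderiv j F).IsHomogeneous 5 := fun j => hF.pderiv
  have hsing : ∀ (x : Fin 4 → ℂ) (hx : x ≠ 0), (∀ j, eval x (pderiv j F) = 0) →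
      IsSingularPt F (Projectivization.mk ℂ x hx) := by
    intro x hx h j
    obtain ⟨a, ha⟩ := Projectivization.exists_smul_eq_mk_rep ℂ x hx
    rw [← ha, Units.smul_def, SexticNodes.eval_smul' (hD j), h j, mul_zero]
  have hN : SexticNodes.NC fun j => pderiv j F := by
    intro u T hT hu0 hup hu
    let g : T → {p : ProjP3 | IsSingularPt F p} := fun t =>
      ⟨Projectivization.mk ℂ (u t) (hu0 t t.2), hsing _ _ (hu t t.2)⟩
    have hg : Function.Injective g := by
      intro s t hst
      by_contra hne
      have h1 := congrArg Subtype.val hst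
      obtain ⟨a, ha⟩ := (Projectivization.mk_eq_mk_iff ℂ _ _ _ _).1 h1
      apply hup s s.2 t t.2 (fun h => hne (Subtype.ext h))
      rw [Submodule.mem_span_singleton]
      exact ⟨a, ha⟩
    have := hfin.to_subtype
    have hTf : Finite T := Finite.of_injective g hg
    exact hT (Set.toFinite T)
  let v : {p : ProjP3 // IsSingularPt F p} → Fin 4 → ℂ := fun p => p.1.rep
  have hv : SexticNodes.PW v := by
    constructor
    · exact fun p => p.1.rep_nonzero
    · intro p q hpq hm
      apply hpq
      rw [Submodule.mem_span_singleton] at hm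
      obtain ⟨a, ha⟩ := hm
      ext1
      rw [← p.1.mk_rep, ← q.1.mk_rep]
      exact (Projectivization.mk_eq_mk_iff' ℂ _ _ _ _).2 ⟨a, ha⟩
  have : Finite {p : ProjP3 // IsSingularPt F p} := hfin.to_subtype
  have := Fintype.ofFinite {p : ProjP3 // IsSingularPt F p}
  have hI := SexticNodes.main_ind hv hD (fun i j => i.2 j) hN (Γ := Finset.univ) (by
    rw [Finset.card_univ, ← Nat.card_eq_fintype_card]
    exact hcard)
  intro p hp
  obtain ⟨G, h1, h2, h3⟩ := hI ⟨p, hp⟩ (Finset.mem_univ _)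
  exact ⟨G, h1, fun q hq hqp => h3 ⟨q, hq⟩ (Finset.mem_univ _)
    (fun h => hqp (congrArg Subtype.val h)), h2⟩
end

section
/- Let Γ be a set of at most 13 distinct points of complex projective space P^3 and let p be a point of P^3 not in Γ, such that the set Γ ∪ {p} is on sextic-node position; since Γ ∪ {p} has at most 14 points, this means precisely that (i) no 6 points of Γ ∪ {p} lie on a line, and (ii) no 11 points of Γ ∪ {p} lie in the common zero locus of a nonzero linear form ℓ and a quadratic form not divisible by ℓ. Then there exists a homogeneous quintic form in 4 variables which vanishes at every point of Γ but does not vanish at p. -/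
open MvPolynomial

namespace QuinticSep

open Finset in
/-- support of a coefficient vector -/
noncomputable def supp {ι : Type*} [Fintype ι] (c : ι → ℂ) : Finset ι := by
  classical exact univ.filter (fun i => c i ≠ 0)

/-- indices where a form vanishes -/
noncomputable def zer {ι : Type*} [Fintype ι] {n : ℕ} (v : ι → Fin n → ℂ)
    (G : MvPolynomial (Fin n) ℂ) : Finset ι := by
  classical exact Finset.univ.filter (fun i => eval (v i) G = 0)

/-- indices of the points on the line through `v i` and `v j` -/
noncomputable def line {ι : Type*} [Fintype ι] {n : ℕ} (v : ι → Fin n → ℂ)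
    (i j : ι) : Finset ι := by
  classical exact Finset.univ.filter (fun k => v k ∈ Submodule.span ℂ {v i, v j})

/-- `c` is a linear relation between the evaluations of degree `d` forms -/
def Rel {ι : Type*} [Fintype ι] {n : ℕ} (v : ι → Fin n → ℂ) (d : ℕ) (c : ι → ℂ) : Prop :=
  ∀ F : MvPolynomial (Fin n) ℂ, F.IsHomogeneous d → ∑ i, c i * eval (v i) F = 0

/-- multiply a relation by a form -/
noncomputable def mulc {ι : Type*} {n : ℕ} (v : ι → Fin n → ℂ) (c : ι → ℂ)
    (G : MvPolynomial (Fin n) ℂ) : ι → ℂ := fun i => c i * eval (v i) G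

/-- nonzero, pairwise non proportional vectors -/
def Distinct {ι : Type*} {n : ℕ} (v : ι → Fin n → ℂ) : Prop :=
  (∀ i, v i ≠ 0) ∧ ∀ i j, v j ∈ Submodule.span ℂ {v i} → j = i

section basic
variable {ι : Type*} [Fintype ι] {n : ℕ} {v : ι → Fin n → ℂ}

@[simp] lemma mem_supp {c : ι → ℂ} {i : ι} : i ∈ supp c ↔ c i ≠ 0 := by simp [supp]
@[simp] lemma mem_zer {G : MvPolynomial (Fin n) ℂ} {i : ι} : i ∈ zer v G ↔ eval (v i) G = 0 := by
  simp [zer]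
@[simp] lemma mem_line {i j k : ι} : k ∈ line v i j ↔ v k ∈ Submodule.span ℂ {v i, v j} := by
  simp [line]

lemma supp_nonempty {c : ι → ℂ} (h : c ≠ 0) : (supp c).Nonempty := by
  obtain ⟨i, hi⟩ := Function.ne_iff.mp h
  exact ⟨i, by simpa using hi⟩

lemma Rel.mulc {d e : ℕ} {c : ι → ℂ} (h : Rel v (d + e) c) {G : MvPolynomial (Fin n) ℂ}
    (hG : G.IsHomogeneous e) : Rel v d (mulc v c G) := by
  intro F hF
  have := h _ (hF.mul hG)
  rw [← this]
  refine Finset.sum_congr rfl fun i _ => ?_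
  simp [QuinticSep.mulc]; ring

open Classical in
lemma supp_mulc (c : ι → ℂ) (G : MvPolynomial (Fin n) ℂ) :
    supp (mulc v c G) = supp c \ zer v G := by
  ext i; simp [mulc]

open Classical in
lemma card_mulc (c : ι → ℂ) (G : MvPolynomial (Fin n) ℂ) :
    (supp (mulc v c G)).card + (supp c ∩ zer v G).card = (supp c).card := by
  rw [supp_mulc, Finset.card_sdiff_add_card_inter]

open Classical in
lemma mulc_ne_zero {c : ι → ℂ} {G : MvPolynomial (Fin n) ℂ}
    (h : (supp c ∩ zer v G).card < (supp c).card) : mulc v c G ≠ 0 := by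
  intro h0
  have := card_mulc (v := v) c G
  rw [h0] at this
  have h1 : supp (0 : ι → ℂ) = ∅ := by ext; simp
  rw [h1] at this
  simp at this; omega

/-- linear functionals as linear forms -/
lemma exists_form (φ : Module.Dual ℂ (Fin n → ℂ)) :
    ∃ L : MvPolynomial (Fin n) ℂ, L.IsHomogeneous 1 ∧ ∀ x, eval x L = φ x := by
  refine ⟨∑ i, C (φ (Pi.single i 1)) * X i, ?_, ?_⟩
  · exact IsHomogeneous.sum _ _ _ fun i _ => isHomogeneous_C_mul_X _ _
  · intro x
    simp only [map_sum, map_mul, eval_C, eval_X]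
    conv_rhs => rw [LinearMap.pi_apply_eq_sum_univ φ x]
    refine Finset.sum_congr rfl fun i _ => ?_
    rw [smul_eq_mul, mul_comm]
    congr 2
    ext j; simp [Pi.single_apply, eq_comm]

/-- separate a subspace from the finitely many points outside it -/
lemma exists_sep (v : ι → Fin n → ℂ) (W : Submodule ℂ (Fin n → ℂ)) :
    ∃ L : MvPolynomial (Fin n) ℂ, L.IsHomogeneous 1 ∧ ∀ i, eval (v i) L = 0 ↔ v i ∈ W := by
  obtain ⟨φ, hφ, h⟩ := Module.Dual.exists_forall_mem_ne_zero_of_forall_exists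
    (K := ℂ) (M := Module.Dual ℂ (Fin n → ℂ)) (ι := {i : ι // v i ∉ W}) W.dualAnnihilator
    (fun i => Module.Dual.eval ℂ _ (v i)) (by
      rintro ⟨i, hi⟩
      obtain ⟨f, hf, hf'⟩ := Submodule.exists_dual_map_eq_bot_of_notMem hi inferInstance
      refine ⟨f, ?_, hf⟩
      rw [Submodule.mem_dualAnnihilator]
      intro w hw
      have : f w ∈ W.map f := Submodule.mem_map_of_mem hw
      rw [hf'] at this
      simpa using this)
  obtain ⟨L, hL, hL'⟩ := exists_form φ
  refine ⟨L, hL, fun i => ?_⟩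
  rw [hL']
  constructor
  · intro h0
    by_contra hi
    exact h ⟨i, hi⟩ h0
  · intro hi
    exact (Submodule.mem_dualAnnihilator φ).1 hφ _ hi

lemma exists_line_form (v : ι → Fin n → ℂ) (i j : ι) :
    ∃ L : MvPolynomial (Fin n) ℂ, L.IsHomogeneous 1 ∧ zer v L = line v i j := by
  obtain ⟨L, h, h'⟩ := exists_sep v (Submodule.span ℂ {v i, v j})
  exact ⟨L, h, by ext k; simp [h']⟩

lemma exists_point_form (hv : Distinct v) (i : ι) :
    ∃ L : MvPolynomial (Fin n) ℂ, L.IsHomogeneous 1 ∧ zer v L = {i} := by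
  obtain ⟨L, h, h'⟩ := exists_sep v (Submodule.span ℂ {v i})
  refine ⟨L, h, ?_⟩
  ext k
  simp only [mem_zer, h', Finset.mem_singleton]
  exact ⟨hv.2 i k, fun h => h ▸ Submodule.mem_span_singleton_self _⟩

lemma exists_empty_form (hv : Distinct v) :
    ∃ L : MvPolynomial (Fin n) ℂ, L.IsHomogeneous 1 ∧ zer v L = ∅ := by
  obtain ⟨L, h, h'⟩ := exists_sep v ⊥
  refine ⟨L, h, ?_⟩
  ext k
  simp [h', hv.1 k]

open Classical in
/-- few points satisfying a relation contain many collinear ones -/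
lemma lemA (hv : Distinct v) (e : ℕ) : ∀ c : ι → ℂ, Rel v e c → c ≠ 0 →
    (supp c).card ≤ 2 * e + 1 → ∃ i j, i ≠ j ∧ e + 2 ≤ (supp c ∩ line v i j).card := by
  induction e with
  | zero =>
    intro c hc h0 hs
    exfalso
    obtain ⟨i, hi⟩ := supp_nonempty h0
    have hs1 : supp c = {i} := by
      rw [Finset.eq_singleton_iff_unique_mem]
      exact ⟨hi, fun j hj => Finset.card_le_one.1 (by omega) _ hj _ hi⟩
    have := hc 1 (isHomogeneous_one _ _)
    simp only [map_one, mul_one] at this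
    rw [Finset.sum_eq_single i] at this
    · exact (mem_supp.1 hi) this
    · intro j _ hj
      by_contra hcj
      have : j ∈ supp c := mem_supp.2 hcj
      rw [hs1] at this
      exact hj (by simpa using this)
    · simp
  | succ e ih =>
    intro c hc h0 hs
    obtain ⟨i, hi⟩ := supp_nonempty h0
    -- at least `e + 3` points
    have hcard : e + 3 ≤ (supp c).card := by
      by_contra hlt
      by_cases h1 : (supp c).card ≤ 1
      · obtain ⟨L, hL, hz⟩ := exists_empty_form hv
        have hk := card_mulc (v := v) c L
        rw [hz] at hk
        simp at hk
        have hpos : 0 < (supp c).card := Finset.card_pos.2 ⟨i, hi⟩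
        obtain ⟨a, b, -, hab⟩ := ih _ (hc.mulc hL) (mulc_ne_zero (by rw [hz]; simpa using ⟨i, hi⟩))
          (by omega)
        have := Finset.card_le_card (Finset.inter_subset_left (s₁ := supp (mulc v c L)) (s₂ := line v a b))
        omega
      · obtain ⟨L, hL, hz⟩ := exists_point_form hv i
        have hk := card_mulc (v := v) c L
        have hone : (supp c ∩ zer v L).card = 1 := by
          rw [hz, Finset.inter_singleton_of_mem hi]; simp
        obtain ⟨a, b, -, hab⟩ := ih _ (hc.mulc hL) (mulc_ne_zero (v := v) (by omega))
          (by omega)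
        have := Finset.card_le_card (Finset.inter_subset_left (s₁ := supp (mulc v c L)) (s₂ := line v a b))
        omega
    -- a line with the most points
    obtain ⟨j, hj, hji⟩ : ∃ j ∈ supp c, j ≠ i := Finset.exists_mem_ne (by omega) i
    let P : Finset (ι × ι) := Finset.univ.filter (fun q => q.1 ≠ q.2)
    obtain ⟨⟨a, b⟩, hab, hmax⟩ := P.exists_max_image
      (fun q => (supp c ∩ line v q.1 q.2).card) ⟨(j, i), by simp [P, hji]⟩
    simp only [P, Finset.mem_filter, Finset.mem_univ, true_and] at hab hmax
    obtain ⟨L, hL, hz⟩ := exists_line_form v a b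
    have hk := card_mulc (v := v) c L
    have h2 : 2 ≤ (supp c ∩ line v a b).card := by
      refine le_trans ?_ (hmax (j, i) hji)
      rw [← Finset.card_pair hji]
      apply Finset.card_le_card
      intro k hk
      simp only [Finset.mem_insert, Finset.mem_singleton] at hk
      rcases hk with rfl | rfl
      · simp only [Finset.mem_inter, hj, mem_line, true_and]
        exact Submodule.subset_span (by simp)
      · simp only [Finset.mem_inter, hi, mem_line, true_and]
        exact Submodule.subset_span (by simp)
    by_cases hall : (supp c ∩ line v a b).card < (supp c).card
    · rw [hz] at hk
      obtain ⟨a', b', hab', hc'⟩ := ih _ (hc.mulc hL) (mulc_ne_zero (v := v) (by rw [hz]; omega))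
        (by omega)
      have h3 := hmax (a', b') hab'
      have h4 : (supp (mulc v c L) ∩ line v a' b').card ≤ (supp c ∩ line v a' b').card := by
        apply Finset.card_le_card
        rw [supp_mulc]
        exact Finset.inter_subset_inter Finset.sdiff_subset le_rfl
      have h5 : (supp (mulc v c L) ∩ line v a' b').card ≤ (supp (mulc v c L)).card :=
        Finset.card_le_card Finset.inter_subset_left
      simp only at h3
      omega
    · exact ⟨a, b, hab, by omega⟩

lemma lemA' (hv : Distinct v) {e : ℕ} {c : ι → ℂ} (hc : Rel v e c) (h0 : c ≠ 0) :
    e + 2 ≤ (supp c).card := by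
  classical
  by_contra h
  obtain ⟨i, j, -, h1⟩ := lemA hv e c hc h0 (by omega)
  have := Finset.card_le_card (Finset.inter_subset_left (s₁ := supp c) (s₂ := line v i j))
  omega

end basic

/-- dimension of the space of forms -/
lemma finrank_hom (n d : ℕ) :
    Module.finrank ℂ (homogeneousSubmodule (Fin n) ℂ d) = (n + d - 1).choose d := by
  classical
  have h : homogeneousSubmodule (Fin n) ℂ d =
      restrictSupport ℂ ((Finset.univ : Finset (Fin n)).finsuppAntidiag d : Set (Fin n →₀ ℕ)) := by
    rw [homogeneousSubmodule_eq_finsupp_supported, restrictSupport]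
    congr 1
    ext x
    simp [Finset.mem_finsuppAntidiag, Finsupp.degree_eq_sum]
  rw [h, Module.finrank_eq_card_basis (basisRestrictSupport ℂ _)]
  simp [Finset.card_finsuppAntidiag_nat_eq_choose]

instance fin_hom (n d : ℕ) : FiniteDimensional ℂ (homogeneousSubmodule (Fin n) ℂ d) :=
  Module.Finite.iff_fg.2 (homogeneousSubmodule_fg _ _ _)

section vanish
variable {ι : Type*} [Fintype ι] {n : ℕ} (v : ι → Fin n → ℂ)

/-- evaluation of degree `d` forms -/
noncomputable def ev (d : ℕ) : homogeneousSubmodule (Fin n) ℂ d →ₗ[ℂ] (ι → ℂ) where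
  toFun F i := eval (v i) F.1
  map_add' F G := by ext; simp
  map_smul' a F := by ext; simp

/-- forms vanishing at few points -/
lemma exists_vanish (d : ℕ) (T : Finset ι) (hT : T.card < (n + d - 1).choose d) :
    ∃ F : MvPolynomial (Fin n) ℂ, F.IsHomogeneous d ∧ F ≠ 0 ∧ T ⊆ zer v F := by
  have h := LinearMap.ker_ne_bot_of_finrank_lt (f := ev (fun i : T => v i) d) (by
    rw [finrank_hom]; simpa using hT)
  obtain ⟨F, hF, hF0⟩ := Submodule.exists_mem_ne_zero_of_ne_bot h
  refine ⟨F.1, F.2, by simpa using hF0, fun i hi => ?_⟩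
  have := congrFun (LinearMap.mem_ker.1 hF) ⟨i, hi⟩
  simpa [ev] using this

open Classical in
/-- a form vanishing on `k` of the points in a set -/
lemma exists_vanish_on (d k : ℕ) (hk : k < (n + d - 1).choose d) (S : Finset ι) :
    ∃ F : MvPolynomial (Fin n) ℂ, F.IsHomogeneous d ∧ F ≠ 0 ∧ min k S.card ≤ (S ∩ zer v F).card := by
  obtain ⟨T, hTS, hT⟩ := Finset.exists_subset_card_eq (min_le_right k S.card)
  obtain ⟨F, h1, h2, h3⟩ := exists_vanish v d T (by omega)
  refine ⟨F, h1, h2, ?_⟩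
  rw [← hT]
  exact Finset.card_le_card (Finset.subset_inter hTS h3)
end vanish

open Classical in
lemma exists_max_form {ι : Type*} [Fintype ι] {n : ℕ} (v : ι → Fin (n + 1) → ℂ) (S : Finset ι) :
    ∃ L : MvPolynomial (Fin (n + 1)) ℂ, L.IsHomogeneous 1 ∧ L ≠ 0 ∧
      ∀ L' : MvPolynomial (Fin (n + 1)) ℂ, L'.IsHomogeneous 1 → L' ≠ 0 →
        (S ∩ zer v L').card ≤ (S ∩ zer v L).card := by
  have hle : ∀ L', (S ∩ zer v L').card ≤ S.card := fun L' =>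
    Finset.card_le_card Finset.inter_subset_left
  have hex : ∃ k, ∃ L : MvPolynomial (Fin (n + 1)) ℂ, L.IsHomogeneous 1 ∧ L ≠ 0 ∧
      (S ∩ zer v L).card + k = S.card :=
    ⟨S.card - (S ∩ zer v (X 0)).card, X 0, isHomogeneous_X _ _, X_ne_zero _, by
      have := hle (X 0); omega⟩
  obtain ⟨L, h1, h2, h3⟩ := Nat.find_spec hex
  refine ⟨L, h1, h2, fun L' h1' h2' => ?_⟩
  have := Nat.find_min' hex ⟨L', h1', h2', (by
    have := hle L'; omega : (S ∩ zer v L').card + (S.card - (S ∩ zer v L').card) = S.card)⟩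
  have := hle L'
  omega

section more
variable {ι : Type*} [Fintype ι] {n : ℕ} {v : ι → Fin n → ℂ}

lemma supp_mulc_subset (c : ι → ℂ) (G : MvPolynomial (Fin n) ℂ) :
    supp (mulc v c G) ⊆ supp c := by
  classical
  rw [supp_mulc]; exact Finset.sdiff_subset

open Classical in
lemma inter_mulc_le (c : ι → ℂ) (G : MvPolynomial (Fin n) ℂ) (T : Finset ι) :
    (supp (mulc v c G) ∩ T).card ≤ (supp c ∩ T).card :=
  Finset.card_le_card (Finset.inter_subset_inter (supp_mulc_subset c G) le_rfl)

open Classical in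
lemma inter_card_le (S T : Finset ι) : (S ∩ T).card ≤ S.card :=
  Finset.card_le_card Finset.inter_subset_left

open Classical in
lemma inter_card_le' (S T : Finset ι) : (S ∩ T).card ≤ T.card :=
  Finset.card_le_card Finset.inter_subset_right

lemma supp_zero_card : (supp (0 : ι → ℂ)).card = 0 := by
  rw [Finset.card_eq_zero]; ext; simp

end more

/-- reduction to the planar case -/
lemma planar_of_rel {ι : Type*} [Fintype ι] (v : ι → Fin 4 → ℂ) (hv : Distinct v)
    (hl : ∀ i j, i ≠ j → (line v i j).card ≤ 5) (c : ι → ℂ) (hc : Rel v 5 c) (h0 : c ≠ 0)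
    (hs : (supp c).card ≤ 14) :
    ∃ L : MvPolynomial (Fin 4) ℂ, L.IsHomogeneous 1 ∧ L ≠ 0 ∧ ∀ i ∈ supp c, eval (v i) L = 0 := by
  classical
  have h3 : ∀ (S : Finset ι) (L : MvPolynomial (Fin 4) ℂ),
      (∀ L' : MvPolynomial (Fin 4) ℂ, L'.IsHomogeneous 1 → L' ≠ 0 →
        (S ∩ zer v L').card ≤ (S ∩ zer v L).card) → min 3 S.card ≤ (S ∩ zer v L).card := by
    intro S L hL
    obtain ⟨F, h1, h2, h3⟩ := exists_vanish_on v 1 3 (by decide) S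
    exact h3.trans (hL F h1 h2)
  obtain ⟨L1, d1, n1, m1⟩ := exists_max_form v (supp c)
  set c1 := mulc v c L1 with hc1
  have k1 := card_mulc (v := v) c L1
  rw [← hc1] at k1
  have t1 := h3 _ _ m1
  have r1 : Rel v 4 c1 := hc.mulc (d := 4) d1
  by_cases z1 : c1 = 0
  · refine ⟨L1, d1, n1, fun i hi => ?_⟩
    have := congrFun z1 i
    simp only [hc1, mulc, Pi.zero_apply, mul_eq_zero] at this
    exact this.resolve_left (mem_supp.1 hi)
  exfalso
  have a1 := lemA' hv r1 z1
  obtain ⟨L2, d2, n2, m2⟩ := exists_max_form v (supp c1)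
  set c2 := mulc v c1 L2 with hc2
  have k2 := card_mulc (v := v) c1 L2
  rw [← hc2] at k2
  have t2 := h3 _ _ m2
  have r2 : Rel v 3 c2 := r1.mulc (d := 3) d2
  have u2 := (inter_mulc_le (v := v) c L1 (zer v L2)).trans (m1 L2 d2 n2)
  rw [← hc1] at u2
  by_cases z2 : c2 = 0
  · rw [z2, supp_zero_card] at k2
    obtain ⟨i, j, hij, h⟩ := lemA hv 4 c1 r1 z1 (by omega)
    have := hl i j hij
    have := inter_card_le' (supp c1) (line v i j)
    omega
  have a2 := lemA' hv r2 z2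
  obtain ⟨L3, d3, n3, m3⟩ := exists_max_form v (supp c2)
  set c3 := mulc v c2 L3 with hc3
  have k3 := card_mulc (v := v) c2 L3
  rw [← hc3] at k3
  have t3 := h3 _ _ m3
  have r3 : Rel v 2 c3 := r2.mulc (d := 2) d3
  have u3 := (inter_mulc_le (v := v) c1 L2 (zer v L3)).trans (m2 L3 d3 n3)
  rw [← hc2] at u3
  by_cases z3 : c3 = 0
  · rw [z3, supp_zero_card] at k3
    omega
  have a3 := lemA' hv r3 z3
  obtain ⟨L4, d4, n4, m4⟩ := exists_max_form v (supp c3)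
  set c4 := mulc v c3 L4 with hc4
  have k4 := card_mulc (v := v) c3 L4
  rw [← hc4] at k4
  have t4 := h3 _ _ m4
  have r4 : Rel v 1 c4 := r3.mulc (d := 1) d4
  have u4 := (inter_mulc_le (v := v) c2 L3 (zer v L4)).trans (m3 L4 d4 n4)
  rw [← hc3] at u4
  by_cases z4 : c4 = 0
  · rw [z4, supp_zero_card] at k4
    omega
  have a4 := lemA' hv r4 z4
  omega

section plane
variable {ι : Type*} [Fintype ι] {v : ι → Fin 3 → ℂ}

open Classical in
/-- no degree 4 relation on at most 11 points without 4 on a line and without 7 on a conic -/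
lemma quartic_step (hv : Distinct v) {c : ι → ℂ} (hc : Rel v 4 c) (h0 : c ≠ 0)
    (hs : (supp c).card ≤ 11)
    (hl : ∀ i j, i ≠ j → (supp c ∩ line v i j).card ≤ 3)
    (hq : ∀ Q : MvPolynomial (Fin 3) ℂ, Q.IsHomogeneous 2 → Q ≠ 0 →
      (supp c ∩ zer v Q).card ≤ 6) : False := by
  have hge : 10 ≤ (supp c).card := by
    by_contra h
    obtain ⟨i, j, hij, h⟩ := lemA hv 4 c hc h0 (by omega)
    have := hl i j hij
    omega
  -- a degree two relation on at most five points is impossible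
  have key : ∀ Q : MvPolynomial (Fin 3) ℂ, Q.IsHomogeneous 2 → Q ≠ 0 →
      ¬ (supp (mulc v c Q)).card ≤ 5 := by
    intro Q hQ hQ0 h5
    have := hq Q hQ hQ0
    obtain ⟨i, j, hij, h⟩ := lemA hv 2 _ (hc.mulc (d := 2) hQ) (mulc_ne_zero (v := v) (by omega)) h5
    have := inter_mulc_le (v := v) c Q (line v i j)
    have := hl i j hij
    omega
  obtain ⟨Q, hQ, hQ0, hQ5⟩ := exists_vanish_on v 2 5 (by decide) (supp c)
  have k := card_mulc (v := v) c Q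
  have := key Q hQ hQ0
  have r := hc.mulc (d := 2) hQ
  set c1 := mulc v c Q with hc1
  obtain ⟨Q', hQ', hQ0', hQ5'⟩ := exists_vanish_on v 2 5 (by decide) (supp c1)
  have k' := card_mulc (v := v) c1 Q'
  by_cases z : mulc v c1 Q' = 0
  · rw [z, supp_zero_card] at k'
    have h6 := inter_mulc_le (v := v) c Q (zer v Q')
    rw [← hc1] at h6
    have := card_mulc (v := v) c Q'
    have := key Q' hQ' hQ0'
    omega
  · have := lemA' hv (r.mulc (d := 0) hQ') z
    omega

end plane

/-- homogeneous cofactor of a linear form -/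
lemma hom_cofactor {n d : ℕ} {l F : MvPolynomial (Fin n) ℂ} (hl : l.IsHomogeneous 1)
    (hF : F.IsHomogeneous (d + 1)) (h : l ∣ F) :
    ∃ k : MvPolynomial (Fin n) ℂ, k.IsHomogeneous d ∧ F = l * k := by
  obtain ⟨k, rfl⟩ := h
  refine ⟨homogeneousComponent d k, homogeneousComponent_isHomogeneous _ _, ?_⟩
  have h1 : homogeneousComponent (d + 1) (l * k) = l * k := homogeneousComponent_eq_self hF
  rw [← h1]
  conv_lhs => rw [← sum_homogeneousComponent k, Finset.mul_sum, map_sum]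
  have h2 : ∀ i, homogeneousComponent (d + 1) (l * homogeneousComponent i k) =
      if i = d then l * homogeneousComponent d k else 0 := by
    intro i
    have h3 : (l * homogeneousComponent i k).IsHomogeneous (1 + i) :=
      hl.mul (homogeneousComponent_isHomogeneous _ _)
    rw [homogeneousComponent_of_mem h3]
    by_cases hi : i = d
    · subst hi; rw [if_pos (by omega), if_pos rfl]
    · rw [if_neg (by omega), if_neg hi]
  simp only [h2, Finset.sum_ite_eq', Finset.mem_range]
  split_ifs with h4
  · rfl
  · rw [homogeneousComponent_eq_zero _ _ (by omega), mul_zero]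

lemma prime_linear {n : ℕ} {l : MvPolynomial (Fin n) ℂ} (hl : l.IsHomogeneous 1) (h0 : l ≠ 0) :
    Prime l := by
  apply Irreducible.prime
  apply irreducible_of_totalDegree_eq_one (hl.totalDegree h0)
  intro x hx
  rw [isUnit_iff_ne_zero]
  rintro rfl
  apply h0
  ext i
  simpa using hx i

open Classical in
/-- relations as a submodule -/
noncomputable def K {ι : Type*} [Fintype ι] {n : ℕ} (v : ι → Fin n → ℂ) (d : ℕ) :
    Submodule ℂ (ι → ℂ) :=
  LinearMap.ker ((ev v d).dualMap ∘ₗ (dotProductEquiv ℂ ι).toLinearMap)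

section dims
variable {ι : Type*} [Fintype ι] {n : ℕ} {v : ι → Fin n → ℂ}

open Classical in
lemma mem_K {d : ℕ} {c : ι → ℂ} : c ∈ K v d ↔ Rel v d c := by
  simp only [K, LinearMap.mem_ker, Rel]
  constructor
  · intro h F hF
    have := LinearMap.congr_fun h ⟨F, hF⟩
    simpa [ev, dotProduct] using this
  · intro h
    ext ⟨F, hF⟩
    simpa [ev, dotProduct] using h F hF

open Classical in
lemma finrank_K (d : ℕ) : Module.finrank ℂ (K v d) + (n + d - 1).choose d =
    Fintype.card ι + Module.finrank ℂ (LinearMap.ker (ev v d)) := by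
  have h1 := LinearMap.finrank_range_add_finrank_ker
    ((ev v d).dualMap ∘ₗ (dotProductEquiv ℂ ι).toLinearMap)
  have h2 := LinearMap.finrank_range_add_finrank_ker (ev v d)
  rw [LinearMap.range_comp_of_range_eq_top _ (LinearEquiv.range _),
    LinearMap.finrank_range_dualMap_eq_finrank_range] at h1
  rw [finrank_hom] at h2
  simp only [Module.finrank_fintype_fun_eq_card] at h1
  rw [K]
  omega

end dims

section plane
variable {ι : Type*} [Fintype ι] {v : ι → Fin 3 → ℂ}

/-- the generic case: a quintic relation on 14 points yields a quartic relation on 11 of them -/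
lemma generic_step (hcard : Fintype.card ι = 14) {c : ι → ℂ} (hc : Rel v 5 c)
    (hne : ∀ i, c i ≠ 0)
    (hq : ∀ Q : MvPolynomial (Fin 3) ℂ, Q.IsHomogeneous 2 → Q ≠ 0 → (zer v Q).card ≤ 6) :
    ∃ c' : ι → ℂ, Rel v 4 c' ∧ c' ≠ 0 ∧ (supp c').card ≤ 11 := by
  classical
  -- conics give cubic relations
  let Ψ : homogeneousSubmodule (Fin 3) ℂ 2 →ₗ[ℂ] K v 3 :=
    { toFun := fun F => ⟨mulc v c F.1, mem_K.2 (hc.mulc (d := 3) F.2)⟩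
      map_add' := fun F G => by ext i; simp [mulc, mul_add]
      map_smul' := fun a F => by ext i; simp [mulc]; ring }
  have hΨ : Function.Injective Ψ := by
    rw [injective_iff_map_eq_zero]
    rintro ⟨F, hF⟩ h
    by_contra h0
    have hF0 : F ≠ 0 := fun h => h0 (by ext1; simpa using h)
    have h6 := hq F hF hF0
    have : zer v F = Finset.univ := by
      ext i
      have := congrFun (congrArg Subtype.val h) i
      simpa [Ψ, mulc, hne i] using this
    rw [this, Finset.card_univ] at h6
    omega
  have h3 := LinearMap.finrank_le_finrank_of_injective hΨ
  have h3' := finrank_K (v := v) 3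
  rw [finrank_hom] at h3
  have e1 : (3 + 2 - 1).choose 2 = 6 := by decide
  have e2 : (3 + 3 - 1).choose 3 = 10 := by decide
  have e3 : (3 + 4 - 1).choose 4 = 15 := by decide
  have e4 : (3 + 1 - 1).choose 1 = 3 := by decide
  rw [e1] at h3
  rw [e2] at h3'
  have h2 : 1 < Module.finrank ℂ (LinearMap.ker (ev v 3)) := by omega
  have : Nontrivial (LinearMap.ker (ev v 3)) := Module.nontrivial_of_finrank_pos (R := ℂ) (by omega)
  obtain ⟨f, hf0⟩ := exists_ne (0 : LinearMap.ker (ev v 3))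
  obtain ⟨g, hfg⟩ := exists_linearIndependent_pair_of_one_lt_finrank
    (R := ℂ) (M := LinearMap.ker (ev v 3)) h2 hf0
  obtain ⟨⟨f, hf⟩, hfk⟩ := f
  obtain ⟨⟨g, hg⟩, hgk⟩ := g
  have hfg := LinearIndependent.pair_iff.1 hfg
  have hind : ∀ s t : ℂ, C s * f + C t * g = 0 → s = 0 ∧ t = 0 := by
    intro s t hst
    apply hfg s t
    ext1; ext1
    simpa [MvPolynomial.smul_eq_C_mul] using hst
  have hfz : ∀ i, eval (v i) f = 0 := fun i => congrFun (LinearMap.mem_ker.1 hfk) i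
  have hgz : ∀ i, eval (v i) g = 0 := fun i => congrFun (LinearMap.mem_ker.1 hgk) i
  have hf0' : f ≠ 0 := by
    rintro rfl
    have := hind 1 0 (by simp)
    simp at this
  have hg0' : g ≠ 0 := by
    rintro rfl
    have := hind 0 1 (by simp)
    simp at this
  let Φ : (homogeneousSubmodule (Fin 3) ℂ 1 × homogeneousSubmodule (Fin 3) ℂ 1) →ₗ[ℂ]
      LinearMap.ker (ev v 4) :=
    { toFun := fun F => ⟨⟨F.1.1 * f + F.2.1 * g,
        ((F.1.2 : IsHomogeneous _ 1).mul hf).add ((F.2.2 : IsHomogeneous _ 1).mul hg)⟩, by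
          rw [LinearMap.mem_ker]; ext i; simp [ev, hfz, hgz]⟩
      map_add' := fun F G => by ext1; ext1; simp; ring
      map_smul' := fun a F => by ext1; ext1; simp [smul_add] }
  have hΦ : Function.Injective Φ := by
    rw [injective_iff_map_eq_zero]
    rintro ⟨⟨l, hl⟩, ⟨m, hm⟩⟩ h
    have h : l * f + m * g = 0 := congrArg (fun x => x.1.1) h
    rw [mem_homogeneousSubmodule] at hl hm
    by_cases hl0 : l = 0
    · subst hl0
      have : m = 0 := by simpa [hg0'] using h
      subst this
      rfl
    exfalso
    have hdvd : l ∣ m * g := ⟨-f, by linear_combination h⟩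
    rcases (prime_linear hl hl0).dvd_or_dvd hdvd with h1 | h1
    · obtain ⟨k, hk, rfl⟩ := hom_cofactor (d := 0) hl hm h1
      have hk' : k = C (coeff 0 k) := by
        rw [← totalDegree_eq_zero_iff_eq_C]
        exact Nat.le_zero.1 hk.totalDegree_le
      have : l * (C 1 * f + C (coeff 0 k) * g) = 0 := by
        rw [← hk', C_1]; linear_combination h
      have := hind _ _ ((mul_eq_zero.1 this).resolve_left hl0)
      simp at this
    · obtain ⟨k, hk, rfl⟩ := hom_cofactor (d := 2) hl hg h1
      have hk0 : k ≠ 0 := by rintro rfl; simp at hg0'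
      have a1 := hq k hk hk0
      have a2 := hq (l * l) (hl.mul hl) (mul_ne_zero hl0 hl0)
      have a3 : (Finset.univ : Finset ι) ⊆ zer v k ∪ zer v (l * l) := by
        intro i _
        have := hgz i
        simp only [map_mul, mul_eq_zero] at this
        simp only [Finset.mem_union, mem_zer, map_mul, mul_eq_zero]
        tauto
      have := (Finset.card_le_card a3).trans (Finset.card_union_le _ _)
      rw [Finset.card_univ] at this
      omega
  have h4 := LinearMap.finrank_le_finrank_of_injective hΦ
  have h4' := finrank_K (v := v) 4
  rw [Module.finrank_prod, finrank_hom, e4] at h4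
  rw [e3] at h4'
  obtain ⟨T, -, hT⟩ := Finset.exists_subset_card_eq (s := (Finset.univ : Finset ι)) (n := 3)
    (by rw [Finset.card_univ]; omega)
  let ρ : K v 4 →ₗ[ℂ] (T → ℂ) := (LinearMap.funLeft ℂ ℂ (Subtype.val : T → ι)) ∘ₗ (K v 4).subtype
  have hρ := LinearMap.ker_ne_bot_of_finrank_lt (f := ρ) (by simp [hT]; omega)
  obtain ⟨c', hc', hc0⟩ := Submodule.exists_mem_ne_zero_of_ne_bot hρ
  refine ⟨c'.1, mem_K.1 c'.2, by simpa using hc0, ?_⟩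
  have : supp c'.1 ⊆ Finset.univ \ T := by
    intro i hi
    simp only [Finset.mem_sdiff, Finset.mem_univ, true_and]
    intro hiT
    exact mem_supp.1 hi (congrFun (LinearMap.mem_ker.1 hc') ⟨i, hiT⟩)
  refine (Finset.card_le_card this).trans ?_
  rw [Finset.card_sdiff_of_subset (Finset.subset_univ _), Finset.card_univ]
  omega

/-- the planar case -/
theorem planar (hv : Distinct v) (hcard : Fintype.card ι ≤ 14)
    (hl : ∀ i j, i ≠ j → (line v i j).card ≤ 5)
    (hq : ∀ Q : MvPolynomial (Fin 3) ℂ, Q.IsHomogeneous 2 → Q ≠ 0 → (zer v Q).card ≤ 10)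
    {c : ι → ℂ} (hc : Rel v 5 c) (h0 : c ≠ 0) : False := by
  classical
  have hs : (supp c).card ≤ 14 := (Finset.card_le_univ _).trans hcard
  have hl5 : ∀ i j, i ≠ j → (supp c ∩ line v i j).card ≤ 5 := fun i j hij =>
    (inter_card_le' _ _).trans (hl i j hij)
  have s1 : 12 ≤ (supp c).card := by
    by_contra h
    obtain ⟨i, j, hij, h⟩ := lemA hv 5 c hc h0 (by omega)
    have := hl5 i j hij
    omega
  have hl4 : ∀ i j, i ≠ j → (supp c ∩ line v i j).card ≤ 4 := by
    intro i j hij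
    by_contra h
    have h5 := hl5 i j hij
    obtain ⟨L, hL, hz⟩ := exists_line_form v i j
    have k := card_mulc (v := v) c L
    rw [hz] at k
    obtain ⟨a, b, hab, h⟩ := lemA hv 4 _ (hc.mulc (d := 4) hL)
      (mulc_ne_zero (v := v) (by rw [hz]; omega)) (by omega)
    have := inter_mulc_le (v := v) c L (line v a b)
    have := hl5 a b hab
    omega
  have hq6 : ∀ Q : MvPolynomial (Fin 3) ℂ, Q.IsHomogeneous 2 → Q ≠ 0 →
      (supp c ∩ zer v Q).card ≤ 6 := by
    intro Q hQ hQ0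
    by_contra h
    have h10 := (inter_card_le' (supp c) (zer v Q)).trans (hq Q hQ hQ0)
    have k := card_mulc (v := v) c Q
    obtain ⟨a, b, hab, h⟩ := lemA hv 3 _ (hc.mulc (d := 3) hQ)
      (mulc_ne_zero (v := v) (by omega)) (by omega)
    have := inter_mulc_le (v := v) c Q (line v a b)
    have := hl4 a b hab
    omega
  have hl3 : ∀ i j, i ≠ j → (supp c ∩ line v i j).card ≤ 3 := by
    intro i j hij
    by_contra h
    have h4 := hl4 i j hij
    obtain ⟨L, hL, hz⟩ := exists_line_form v i j
    have k := card_mulc (v := v) c L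
    have r := hc.mulc (d := 4) hL
    rw [hz] at k
    set c1 := mulc v c L with hc1
    obtain ⟨Q, hQ, hQ0, hQ5⟩ := exists_vanish_on v 2 5 (by decide) (supp c1)
    have q6 := hq6 Q hQ hQ0
    have q6' := inter_mulc_le (v := v) c L (zer v Q)
    rw [← hc1] at q6'
    have k1 := card_mulc (v := v) c1 Q
    obtain ⟨a, b, hab, h2⟩ := lemA hv 2 _ (r.mulc (d := 2) hQ)
      (mulc_ne_zero (v := v) (by omega)) (by omega)
    have h3 := inter_mulc_le (v := v) c1 Q (line v a b)
    have h3' := inter_mulc_le (v := v) c L (line v a b)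
    rw [← hc1] at h3'
    obtain ⟨L', hL', hz'⟩ := exists_line_form v a b
    have k2 := card_mulc (v := v) c1 L'
    rw [hz'] at k2
    have h4' := hl4 a b hab
    obtain ⟨a', b', hab', h5⟩ := lemA hv 3 _ (r.mulc (d := 3) hL')
      (mulc_ne_zero (v := v) (by rw [hz']; omega)) (by omega)
    have h6 := inter_mulc_le (v := v) c1 L' (line v a' b')
    have h6' := inter_mulc_le (v := v) c L (line v a' b')
    rw [← hc1] at h6'
    have := hl4 a' b' hab'
    omega
  -- any nonzero quartic relation supported in `supp c` has at least 12 points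
  have fin : ∀ c' : ι → ℂ, Rel v 4 c' → c' ≠ 0 → supp c' ⊆ supp c → 12 ≤ (supp c').card := by
    intro c' hc' h0' hsub
    by_contra hlt
    refine quartic_step hv hc' h0' (by omega) (fun i j hij => ?_) (fun Q hQ hQ0 => ?_)
    · exact (Finset.card_le_card (Finset.inter_subset_inter hsub le_rfl)).trans (hl3 i j hij)
    · exact (Finset.card_le_card (Finset.inter_subset_inter hsub le_rfl)).trans (hq6 Q hQ hQ0)
  by_cases h14 : (supp c).card = 14
  · have huniv : supp c = Finset.univ := by
      apply Finset.eq_univ_of_card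
      have := Finset.card_le_univ (supp c)
      omega
    obtain ⟨c', h1, h2, h3⟩ := generic_step (v := v) (c := c) (by
        rw [← Finset.card_univ, ← huniv, h14]) hc
      (fun i => mem_supp.1 (huniv ▸ Finset.mem_univ i))
      (fun Q hQ hQ0 => by simpa [huniv] using hq6 Q hQ hQ0)
    have := fin c' h1 h2 (by rw [huniv]; exact Finset.subset_univ _)
    omega
  · obtain ⟨F, hF, hF0, hF2⟩ := exists_vanish_on v 1 2 (by decide) (supp c)
    have k := card_mulc (v := v) c F
    have a2 := hq6 (F * F) (hF.mul hF) (mul_ne_zero hF0 hF0)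
    have hz : zer v (F * F) = zer v F := by ext; simp
    rw [hz] at a2
    have := fin _ (hc.mulc (d := 4) hF) (mulc_ne_zero (v := v) (by omega)) (supp_mulc_subset c F)
    omega
end plane

/-- substitute a linear map in a form -/
lemma exists_subst {a b d : ℕ} (T : (Fin a → ℂ) →ₗ[ℂ] (Fin b → ℂ)) {F : MvPolynomial (Fin b) ℂ}
    (hF : F.IsHomogeneous d) :
    ∃ F' : MvPolynomial (Fin a) ℂ, F'.IsHomogeneous d ∧ ∀ x, eval x F' = eval (T x) F := by
  choose G hG hG' using fun j : Fin b => exists_form (LinearMap.proj j ∘ₗ T)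
  refine ⟨aeval G F, ?_, fun x => ?_⟩
  · simpa using hF.aeval G hG
  · rw [← MvPolynomial.coe_aeval_eq_eval, ← MvPolynomial.coe_aeval_eq_eval]
    change (aeval x) (aeval G F) = aeval (T x) F
    rw [← AlgHom.comp_apply, comp_aeval]
    congr 2
    funext j
    change aeval x (G j) = T x j
    rw [MvPolynomial.aeval_eq_eval]
    exact hG' j x

/-- the linear functional of a linear form -/
lemma exists_functional {n : ℕ} {L : MvPolynomial (Fin n) ℂ} (hL : L.IsHomogeneous 1) :
    ∃ φ : Module.Dual ℂ (Fin n → ℂ), ∀ x, φ x = eval x L := by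
  have h : L ∈ homogeneousSubmodule (Fin n) ℂ 1 := hL
  rw [homogeneousSubmodule_one_eq_span_X] at h
  induction h using Submodule.span_induction with
  | mem x hx =>
    obtain ⟨i, rfl⟩ := hx
    exact ⟨LinearMap.proj i, fun x => by simp⟩
  | zero => exact ⟨0, fun x => by simp⟩
  | add x y hx hy h1 h2 =>
    rw [← homogeneousSubmodule_one_eq_span_X] at hx hy
    obtain ⟨f, hf⟩ := h1 hx
    obtain ⟨g, hg⟩ := h2 hy
    exact ⟨f + g, fun z => by simp [hf, hg]⟩
  | smul a x hx h1 =>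
    rw [← homogeneousSubmodule_one_eq_span_X] at hx
    obtain ⟨f, hf⟩ := h1 hx
    exact ⟨a • f, fun z => by simp [hf]⟩

theorem spatial {ι : Type*} [Fintype ι] (v : ι → Fin 4 → ℂ) (hv : Distinct v)
    (hcard : Fintype.card ι ≤ 14)
    (hl : ∀ i j, i ≠ j → (line v i j).card ≤ 5)
    (hq : ∀ ℓ Q : MvPolynomial (Fin 4) ℂ, ℓ.IsHomogeneous 1 → ℓ ≠ 0 → Q.IsHomogeneous 2 → ¬ ℓ ∣ Q →
      ∀ T : Finset ι, T ⊆ zer v ℓ → T ⊆ zer v Q → T.card ≤ 10)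
    {c : ι → ℂ} (hc : Rel v 5 c) (h0 : c ≠ 0) : False := by
  classical
  obtain ⟨L, hL, hL0, hz⟩ := planar_of_rel v hv hl c hc h0 ((Finset.card_le_univ _).trans hcard)
  obtain ⟨φ, hφ⟩ := exists_functional hL
  have hφ0 : φ ≠ 0 := by
    rintro rfl
    apply hL0
    apply MvPolynomial.funext
    intro x
    rw [← hφ]; simp
  have hrank : Module.finrank ℂ (LinearMap.ker φ) = 3 := by
    have h1 := LinearMap.finrank_range_add_finrank_ker φ
    rw [LinearMap.range_eq_top.2 (LinearMap.surjective hφ0)] at h1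
    simp at h1
    omega
  let A := LinearEquiv.ofFinrankEq (Fin 3 → ℂ) (LinearMap.ker φ) (by rw [hrank]; simp)
  let A' : (Fin 3 → ℂ) →ₗ[ℂ] (Fin 4 → ℂ) := (LinearMap.ker φ).subtype ∘ₗ A.toLinearMap
  have hA' : LinearMap.ker A' = ⊥ := by
    rw [LinearMap.ker_eq_bot]
    exact Subtype.val_injective.comp A.injective
  obtain ⟨B, hB⟩ := LinearMap.exists_leftInverse_of_injective A' hA'
  have hBA : ∀ x, B (A' x) = x := fun x => LinearMap.congr_fun hB x
  have hφA : ∀ x, φ (A' x) = 0 := fun x => (A x).2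
  have hAB : ∀ i ∈ supp c, A' (B (v i)) = v i := by
    intro i hi
    have h1 : v i ∈ LinearMap.ker φ := by rw [LinearMap.mem_ker, hφ]; exact hz i hi
    have h2 : A' (A.symm ⟨v i, h1⟩) = v i := by simp [A']
    rw [← h2, hBA]
  let u : supp c → Fin 3 → ℂ := fun i => B (v i)
  have hu : ∀ i : supp c, A' (u i) = v i := fun i => hAB i i.2
  refine planar (v := u) (c := fun i => c i) ⟨?_, ?_⟩ ?_ ?_ ?_ ?_ ?_
  · intro i h
    have := hu i
    rw [h, map_zero] at this
    exact hv.1 i this.symm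
  · intro i j h
    obtain ⟨a, ha⟩ := Submodule.mem_span_singleton.1 h
    apply Subtype.ext
    apply hv.2
    rw [← hu j, ← ha, map_smul, hu i]
    exact Submodule.smul_mem _ _ (Submodule.mem_span_singleton_self _)
  · exact (Fintype.card_coe (supp c)).le.trans ((Finset.card_le_univ (supp c)).trans hcard)
  · intro i j hij
    refine le_trans ?_ (hl i j (fun h => hij (Subtype.ext h)))
    apply Finset.card_le_card_of_injOn Subtype.val _ Subtype.val_injective.injOn
    intro k hk
    have hk := mem_line.1 (Finset.mem_coe.1 hk)
    rw [Finset.mem_coe, mem_line]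
    rw [Submodule.mem_span_pair] at hk ⊢
    obtain ⟨a, b, hab⟩ := hk
    exact ⟨a, b, by rw [← hu i, ← hu j, ← hu k, ← hab]; simp⟩
  · intro Q hQ hQ0
    obtain ⟨Q', hQ', hQe⟩ := exists_subst B hQ
    have := hq L Q' hL hL0 hQ' (by
      rintro ⟨R, rfl⟩
      apply hQ0
      apply MvPolynomial.funext
      intro x
      rw [← hBA x, ← hQe, map_mul, ← hφ, hφA]
      simp) ((zer u Q).map (Function.Embedding.subtype _)) (by
        intro k hk
        obtain ⟨i, -, rfl⟩ := Finset.mem_map.1 hk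
        exact mem_zer.2 (hz i i.2)) (by
        intro k hk
        obtain ⟨i, hi, rfl⟩ := Finset.mem_map.1 hk
        have hi := mem_zer.1 hi
        rw [mem_zer, hQe]
        exact hi)
    simpa using this
  · intro F hF
    obtain ⟨F', hF', hFe⟩ := exists_subst B hF
    have := hc F' hF'
    rw [← this]
    rw [← Finset.sum_subset (f := fun i => c i * eval (v i) F') (Finset.subset_univ (supp c)),
      ← Finset.sum_coe_sort (supp c) (fun i => c i * eval (v i) F')]
    · refine Finset.sum_congr rfl fun i _ => ?_
      rw [hFe]
    · intro i _ hi
      have : c i = 0 := by simpa using hi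
      rw [this, zero_mul]
  · intro h
    apply h0
    funext i
    by_contra hi
    exact hi (congrFun h ⟨i, mem_supp.2 hi⟩)

end QuinticSep

/-- Let `Γ` be a set of at most 13 distinct points of `ℙ³(ℂ)` and
`p ∉ Γ` a further point such that `Γ ∪ {p}` is on sextic-node position, i.e.
(i) no 6 points of `Γ ∪ {p}` lie on a line (the projectivization of a 2-dimensional
linear subspace of `ℂ⁴`), and (ii) no 11 points of `Γ ∪ {p}` lie in the common zero
locus of a nonzero linear form `ℓ` and a quadratic form not divisible by `ℓ`.
Then there is a homogeneous quintic form vanishing at every point of `Γ` but not at `p`. -/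
theorem stmt1 (Γ : Finset ProjP3) (hΓ : Γ.card ≤ 13) (p : ProjP3) (hp : p ∉ Γ)
    (hline : ∀ W : Submodule ℂ (Fin 4 → ℂ), Module.finrank ℂ W = 2 →
      ({q : ProjP3 | (q = p ∨ q ∈ Γ) ∧ q.rep ∈ W}).ncard ≤ 5)
    (hconic : ∀ ℓ Q : MvPolynomial (Fin 4) ℂ, ℓ.IsHomogeneous 1 → ℓ ≠ 0 →
      Q.IsHomogeneous 2 → ¬ ℓ ∣ Q →
      ({q : ProjP3 | (q = p ∨ q ∈ Γ) ∧ eval q.rep ℓ = 0 ∧ eval q.rep Q = 0}).ncard ≤ 10) :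
    ∃ G : MvPolynomial (Fin 4) ℂ, G.IsHomogeneous 5 ∧
      (∀ q ∈ Γ, eval q.rep G = 0) ∧ eval p.rep G ≠ 0 := by
  classical
  let S : Finset ProjP3 := insert p Γ
  have hS : ∀ q, q ∈ S ↔ (q = p ∨ q ∈ Γ) := fun q => Finset.mem_insert
  let v : S → Fin 4 → ℂ := fun q => q.1.rep
  have hcard : Fintype.card S ≤ 14 := by
    simp only [Fintype.card_coe, S]
    exact (Finset.card_insert_le _ _).trans (by omega)
  have hv : QuinticSep.Distinct v := by
    refine ⟨fun i => i.1.rep_nonzero, fun i j h => ?_⟩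
    obtain ⟨a, ha⟩ := Submodule.mem_span_singleton.1 h
    apply Subtype.ext
    rw [← j.1.mk_rep, ← i.1.mk_rep, Projectivization.mk_eq_mk_iff']
    exact ⟨a, ha⟩
  have hncard : ∀ (T : Finset S) (P : Set ProjP3) (k : ℕ), P ⊆ {q | q = p ∨ q ∈ Γ} →
      (∀ q ∈ T, q.1 ∈ P) → P.ncard ≤ k → T.card ≤ k := by
    intro T P k hP hT hk
    refine le_trans ?_ hk
    rw [← Finset.card_map (Function.Embedding.subtype _), ← Set.ncard_coe_finset]
    apply Set.ncard_le_ncard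
    · intro q hq
      obtain ⟨i, hi, rfl⟩ := Finset.mem_map.1 (Finset.mem_coe.1 hq)
      exact hT i hi
    · apply Set.Finite.subset S.finite_toSet
      intro q hq
      exact (hS q).2 (hP hq)
  have hK : QuinticSep.K v 5 = ⊥ := by
    rw [Submodule.eq_bot_iff]
    intro c hc
    by_contra h0
    refine QuinticSep.spatial v hv hcard ?_ ?_ (QuinticSep.mem_K.1 hc) h0
    · intro i j hij
      refine hncard _ _ 5 (fun q hq => hq.1) ?_ (hline (Submodule.span ℂ {v i, v j}) ?_)
      · intro q hq
        exact ⟨(hS q).1 q.2, QuinticSep.mem_line.1 hq⟩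
      · have hli : LinearIndependent ℂ ![v i, v j] := by
          rw [LinearIndependent.pair_iff' (hv.1 i)]
          intro a ha
          exact hij (hv.2 i j (Submodule.mem_span_singleton.2 ⟨a, ha⟩)).symm
        have := finrank_span_eq_card hli
        have hr : Set.range ![v i, v j] = {v i, v j} := by
          ext x
          simp [or_comm]
        rw [hr] at this
        simpa using this
    · intro ℓ Q h1 h2 h3 h4 T hT1 hT2
      refine hncard _ _ 10 (fun q hq => hq.1) ?_ (hconic ℓ Q h1 h2 h3 h4)
      intro q hq
      exact ⟨(hS q).1 q.2, (QuinticSep.mem_zer (v := v)).1 (hT1 hq), (QuinticSep.mem_zer (v := v)).1 (hT2 hq)⟩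
  have hsurj : Function.Surjective (QuinticSep.ev v 5) := by
    rw [← LinearMap.range_eq_top]
    apply Submodule.eq_top_of_finrank_eq
    have h1 := QuinticSep.finrank_K (v := v) 5
    have h2 := LinearMap.finrank_range_add_finrank_ker (QuinticSep.ev v 5)
    rw [QuinticSep.finrank_hom] at h2
    rw [hK, finrank_bot] at h1
    rw [Module.finrank_fintype_fun_eq_card]
    omega
  obtain ⟨F, hF⟩ := hsurj (Pi.single ⟨p, (hS p).2 (Or.inl rfl)⟩ 1)
  refine ⟨F.1, F.2, fun q hq => ?_, ?_⟩
  · have := congrFun hF ⟨q, (hS q).2 (Or.inr hq)⟩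
    rw [Pi.single_eq_of_ne] at this
    · exact this
    · intro h
      have hqp : q = p := congrArg Subtype.val h
      exact hp (hqp ▸ hq)
  · have := congrFun hF ⟨p, (hS p).2 (Or.inl rfl)⟩
    rw [Pi.single_eq_same] at this
    change eval p.rep F.1 = 1 at this
    rw [this]
    exact one_ne_zero
end

section
/- Let F be a homogeneous sextic form in the complex variables x, y, z, w, and suppose the line L = {x = y = 0} is contained in S = Z(F) and that L contains exactly 4 singular points of S, each of which is a simple double point. Let p(z,w) = (∂F/∂x)(0,0,z,w) and q(z,w) = (∂F/∂y)(0,0,z,w), which are binary quintic forms. Then gcd(p, q) is squarefree of degree exactly 4, and its zeros in P^1 ≅ L are exactly the four singular points of S lying on L. -/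
open MvPolynomial

/-- Restriction of a polynomial in the variables `x, y, z, w` (indexed `0,1,2,3`) to the
line `L = {x = y = 0}`, as a binary form in the coordinates `z, w` of `L ≅ ℙ¹`. -/
noncomputable def restrictToL (G : MvPolynomial (Fin 4) ℂ) : MvPolynomial (Fin 2) ℂ :=
  MvPolynomial.aeval ![0, 0, (X 0 : MvPolynomial (Fin 2) ℂ), X 1] G


lemma aeval_mul_hom {σ A : Type*} [CommRing A] [Algebra ℂ A] {f : MvPolynomial σ ℂ} {n : ℕ}
    (hf : f.IsHomogeneous n) (c : A) (x : σ → A) :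
    aeval (fun i => c * x i) f = c ^ n * aeval x f := by
  rw [aeval_def, aeval_def, eval₂_eq, eval₂_eq, Finset.mul_sum]
  refine Finset.sum_congr rfl fun d hd => ?_
  have h := hf.degree_eq_sum_deg_support hd
  simp only [mul_pow, Finset.prod_mul_distrib, Finset.prod_pow_eq_pow_sum]
  rw [h]
  ring

lemma pderiv_hom {σ : Type*} {f : MvPolynomial σ ℂ} {n : ℕ}
    (hf : f.IsHomogeneous (n + 1)) (i : σ) : (pderiv i f).IsHomogeneous n := by
  exact hf.pderiv

lemma pderiv_swap {σ : Type*} (f : MvPolynomial σ ℂ) (i j : σ) :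
    pderiv i (pderiv j f) = pderiv j (pderiv i f) := by
  classical
  have h : ⁅(pderiv i : Derivation ℂ (MvPolynomial σ ℂ) (MvPolynomial σ ℂ)),
      (pderiv j : Derivation ℂ (MvPolynomial σ ℂ) (MvPolynomial σ ℂ))⁆ = 0 := by
    apply MvPolynomial.derivation_ext
    intro k
    simp only [Derivation.commutator_apply, pderiv_X, Pi.single_apply]
    split_ifs <;> simp
  have := congrArg (fun D => D f) h
  simpa [Derivation.commutator_apply, sub_eq_zero] using this

lemma pderiv_restrict (G : MvPolynomial (Fin 4) ℂ) (i : Fin 2) :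
    pderiv i (restrictToL G) = restrictToL (pderiv (Fin.natAdd 2 i) G) := by
  unfold restrictToL
  induction G using MvPolynomial.induction_on with
  | C a => simp
  | add p q hp hq => simp only [map_add, hp, hq]
  | mul_X p k hp =>
    simp only [map_mul, pderiv_mul, map_add, hp, aeval_X]
    congr 2
    fin_cases i <;> fin_cases k <;> simp [pderiv_X, Pi.single_apply, Fin.natAdd]

lemma eval_restrict (G : MvPolynomial (Fin 4) ℂ) (v : Fin 2 → ℂ) :
    eval v (restrictToL G) = eval ![0, 0, v 0, v 1] G := by
  unfold restrictToL
  induction G using MvPolynomial.induction_on with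
  | C a => simp
  | add p q hp hq => simp only [map_add, hp, hq]
  | mul_X p k hp =>
    simp only [map_mul, hp, aeval_X, eval_X]
    fin_cases k <;> simp

lemma restrict_hom {G : MvPolynomial (Fin 4) ℂ} {n : ℕ} (h : G.IsHomogeneous n) :
    (restrictToL G).IsHomogeneous n := by
  have := h.aeval (S := ℂ) (n := 1) ![0, 0, (X 0 : MvPolynomial (Fin 2) ℂ), X 1] (by
    intro i
    fin_cases i
    · exact isHomogeneous_zero _ _ _
    · exact isHomogeneous_zero _ _ _
    · exact isHomogeneous_X _ _
    · exact isHomogeneous_X _ _)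
  simpa [restrictToL] using this

/-- The linear form vanishing at `v`. -/
noncomputable def lin (v : Fin 2 → ℂ) : MvPolynomial (Fin 2) ℂ := C (v 1) * X 0 - C (v 0) * X 1

lemma lin_hom (v : Fin 2 → ℂ) : (lin v).IsHomogeneous 1 :=
  (isHomogeneous_C_mul_X _ _).sub (isHomogeneous_C_mul_X _ _)

lemma eval_lin (u v : Fin 2 → ℂ) : eval u (lin v) = v 1 * u 0 - v 0 * u 1 := by simp [lin]

lemma lin_ne {v : Fin 2 → ℂ} (hv : v ≠ 0) : lin v ≠ 0 := by
  intro h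
  apply hv
  have h0 := eval_lin ![1, 0] v
  have h1 := eval_lin ![0, 1] v
  rw [h] at h0 h1
  ext i
  fin_cases i
  · simpa using h1
  · simpa using h0.symm

lemma isUnit_of_dvd_X {h : MvPolynomial (Fin 2) ℂ} (h0 : h ∣ X 0) (h1 : h ∣ X 1) : IsUnit h := by
  obtain ⟨a, ha⟩ := h0
  rcases (X_prime (R := ℂ) (i := (0 : Fin 2))).irreducible.isUnit_or_isUnit ha with h | h
  · exact h
  · exfalso
    have : (X 0 : MvPolynomial (Fin 2) ℂ) ∣ X 1 :=
      (ha ▸ (h.mul_right_dvd).2 dvd_rfl : (X 0 : MvPolynomial (Fin 2) ℂ) ∣ _).trans h1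
    simp [X_dvd_X] at this

lemma dvd_X_of_det {A : MvPolynomial (Fin 2) ℂ} {a b c d : ℂ} (hdet : a * d - b * c ≠ 0)
    {h : MvPolynomial (Fin 2) ℂ} (h1 : h ∣ A * (C a * X 0 + C b * X 1))
    (h2 : h ∣ A * (C c * X 0 + C d * X 1)) : h ∣ A * X 0 ∧ h ∣ A * X 1 := by
  have hu : IsUnit (C (a * d - b * c) : MvPolynomial (Fin 2) ℂ) :=
    (isUnit_iff_ne_zero.2 hdet).map C
  constructor
  · rw [← hu.dvd_mul_left]
    convert dvd_sub (h1.mul_left (C d)) (h2.mul_left (C b)) using 1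
    simp only [map_sub, map_mul]; ring
  · rw [← hu.dvd_mul_left]
    convert dvd_sub (h2.mul_left (C a)) (h1.mul_left (C c)) using 1
    simp only [map_sub, map_mul]; ring

lemma lin_relPrime {u v : Fin 2 → ℂ} (h : v 1 * u 0 - v 0 * u 1 ≠ 0) :
    IsRelPrime (lin u) (lin v) := by
  intro k hu hv
  have := dvd_X_of_det (A := 1) (a := u 1) (b := - u 0) (c := v 1) (d := - v 0) (h := k)
    (by intro h'; apply h; linear_combination h')
    (by convert hu using 1; simp [lin]; ring) (by convert hv using 1; simp [lin]; ring)
  exact isUnit_of_dvd_X (by simpa using this.1) (by simpa using this.2)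

lemma lin_sqfree {v : Fin 2 → ℂ} (hv : v ≠ 0) : Squarefree (lin v) := by
  rintro h ⟨c, hc⟩
  have hne := lin_ne hv
  have hd := (lin_hom v).totalDegree hne
  rw [hc] at hne
  have hc0 : c ≠ 0 := right_ne_zero_of_mul hne
  have hh0 : h ≠ 0 := left_ne_zero_of_mul (left_ne_zero_of_mul hne)
  rw [hc, totalDegree_mul_of_isDomain (mul_ne_zero hh0 hh0) hc0,
    totalDegree_mul_of_isDomain hh0 hh0] at hd
  have h0 : h.totalDegree = 0 := by omega
  rw [totalDegree_eq_zero_iff_eq_C] at h0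
  rw [h0] at hh0 ⊢
  exact (isUnit_iff_ne_zero.2 (by simpa using hh0)).map C

lemma lin_dvd {f : MvPolynomial (Fin 2) ℂ} {n : ℕ} (hf : f.IsHomogeneous n) {v : Fin 2 → ℂ}
    (hv : v ≠ 0) (h0 : eval v f = 0) : lin v ∣ f := by
  obtain ⟨k, hk⟩ : ∃ k, v k ≠ 0 := by
    by_contra! h
    exact hv (funext h)
  let π := Ideal.Quotient.mkₐ ℂ (Ideal.span {lin v})
  have hπ : π (C (v 1) * X 0) = π (C (v 0) * X 1) := by
    rw [← sub_eq_zero, ← map_sub]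
    exact Ideal.Quotient.eq_zero_iff_mem.2 (Ideal.mem_span_singleton_self _)
  have key : π (C (v k) ^ n * f) = 0 := by
    have e1 : C (v k) ^ n * f = aeval (fun i => C (v k) * X i) f := by
      rw [aeval_mul_hom hf]; simp
    have e2 : π (aeval (fun i => C (v k) * X i) f) =
        π (aeval (fun i => X k * C (v i)) f) := by
      rw [← AlgHom.comp_apply, ← AlgHom.comp_apply, comp_aeval, comp_aeval]
      congr 2
      ext i
      fin_cases k <;> fin_cases i <;> simp only [Fin.zero_eta, Fin.mk_one, mul_comm (X _)] at hπ ⊢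
      · exact hπ.symm
      · exact hπ
    rw [e1, e2, aeval_mul_hom hf]
    have e3 : aeval (fun i => (C (v i) : MvPolynomial (Fin 2) ℂ)) f = C (eval v f) := by
      have := MvPolynomial.aeval_algebraMap_apply (MvPolynomial (Fin 2) ℂ) v f
      simpa [Function.comp_def, algebraMap_eq] using this
    rw [e3, h0]; simp
  have hd : lin v ∣ C (v k) ^ n * f :=
    Ideal.mem_span_singleton.1 (Ideal.Quotient.eq_zero_iff_mem.1 key)
  have hu : IsUnit (C (v k) ^ n : MvPolynomial (Fin 2) ℂ) :=
    ((isUnit_iff_ne_zero.2 hk).map C).pow n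
  exact (hu.dvd_mul_left).1 hd

lemma hom_quot {g f : MvPolynomial (Fin 2) ℂ} (hg : g.IsHomogeneous 4) (hf : f.IsHomogeneous 5)
    (h : g ∣ f) : ∃ a b : ℂ, f = g * (C a * X 0 + C b * X 1) := by
  obtain ⟨r, rfl⟩ := h
  have h1 : g * r = g * homogeneousComponent 1 r := by
    conv_lhs => rw [← homogeneousComponent_eq_self hf]
    conv_lhs => rw [← sum_homogeneousComponent r, Finset.mul_sum, map_sum]
    have : ∀ i, homogeneousComponent 5 (g * homogeneousComponent i r) =
        if i = 1 then g * homogeneousComponent 1 r else 0 := by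
      intro i
      have := (hg.mul (homogeneousComponent_isHomogeneous i r))
      rw [homogeneousComponent_of_mem this]
      by_cases hi : i = 1
      · simp [hi]
      · simp [hi]; intro; omega
    simp only [this]
    rw [Finset.sum_ite_eq']
    split_ifs with hh
    · rfl
    · rw [homogeneousComponent_eq_zero]; · simp
      simp at hh; omega
  have h2 : homogeneousComponent 1 r ∈ homogeneousSubmodule (Fin 2) ℂ 1 :=
    homogeneousComponent_mem _ _
  rw [homogeneousSubmodule_one_eq_span_X] at h2
  rw [Submodule.mem_span_range_iff_exists_fun] at h2
  obtain ⟨c, hc⟩ := h2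
  refine ⟨c 0, c 1, ?_⟩
  rw [h1, ← hc]
  simp [Fin.sum_univ_two, smul_eq_C_mul]

lemma dvd_of_dvd_X {h g : MvPolynomial (Fin 2) ℂ} (h0 : h ∣ g * X 0) (h1 : h ∣ g * X 1) :
    h ∣ g := by
  by_cases hh : h = 0
  · subst hh
    simpa using h0
  obtain ⟨a, ha⟩ := h0
  obtain ⟨b, hb⟩ := h1
  have : a * X 1 = b * X 0 := by
    apply mul_left_cancel₀ hh
    linear_combination (-X 1) * ha + X 0 * hb
  have hd : (X 0 : MvPolynomial (Fin 2) ℂ) ∣ a * X 1 := ⟨b, by rw [this, mul_comm]⟩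
  rcases X_prime.dvd_or_dvd hd with ⟨c, rfl⟩ | h
  · refine ⟨c, mul_right_cancel₀ (X_ne_zero (0 : Fin 2)) ?_⟩
    rw [ha]; ring
  · simp [X_dvd_X] at h

lemma rank_block (M : Matrix (Fin 4) (Fin 4) ℂ)
    (h : ∀ i j : Fin 4, (2 ≤ i.val ∨ 2 ≤ j.val) → M i j = 0) : M.rank ≤ 2 := by
  have : M = (Matrix.of fun (i : Fin 4) (j : Fin 2) => M i (Fin.castAdd 2 j)) *
      (Matrix.of fun (i : Fin 2) (j : Fin 4) => if i.val = j.val then (1 : ℂ) else 0) := by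
    ext i j
    simp only [Matrix.mul_apply, Fin.sum_univ_two, Matrix.of_apply]
    fin_cases j
    · simp
    · simp
    · simpa using h i 2 (by simp)
    · simpa using h i 3 (by simp)
  rw [this]
  exact (Matrix.rank_mul_le_left _ _).trans (Matrix.rank_le_width _)

/-- Let `F` be a homogeneous sextic in `x, y, z, w` such that the line
`L = {x = y = 0}` lies on `S = Z(F)` and contains exactly 4 singular points of `S`, each
a simple double point. Let `p(z,w) = (∂F/∂x)(0,0,z,w)` and `q(z,w) = (∂F/∂y)(0,0,z,w)`,
binary quintic forms. Then `gcd(p, q)` is squarefree of degree exactly 4, and its zeros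
in `ℙ¹ ≅ L` are exactly the four singular points of `S` lying on `L`. -/
theorem stmt9 (F : MvPolynomial (Fin 4) ℂ) (hF : F.IsHomogeneous 6)
    (hLS : ∀ v : Fin 2 → ℂ, eval ![0, 0, v 0, v 1] F = 0)
    (hsing4 : {t : Projectivization ℂ (Fin 2 → ℂ) |
        ∀ j : Fin 4, eval ![0, 0, t.rep 0, t.rep 1] (pderiv j F) = 0}.ncard = 4)
    (hnode : ∀ v : Fin 2 → ℂ, v ≠ 0 →
      (∀ j : Fin 4, eval ![0, 0, v 0, v 1] (pderiv j F) = 0) →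
      (Matrix.of fun (i j : Fin 4) =>
        eval ![0, 0, v 0, v 1] (pderiv i (pderiv j F))).rank = 3) :
    ∃ g : MvPolynomial (Fin 2) ℂ,
      g ∣ restrictToL (pderiv 0 F) ∧ g ∣ restrictToL (pderiv 1 F) ∧
      (∀ h : MvPolynomial (Fin 2) ℂ,
        h ∣ restrictToL (pderiv 0 F) → h ∣ restrictToL (pderiv 1 F) → h ∣ g) ∧
      Squarefree g ∧ g ≠ 0 ∧ g.IsHomogeneous 4 ∧
      (∀ v : Fin 2 → ℂ, v ≠ 0 →
        (eval v g = 0 ↔ ∀ j : Fin 4, eval ![0, 0, v 0, v 1] (pderiv j F) = 0)) := by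
  classical
  set S := {t : Projectivization ℂ (Fin 2 → ℂ) |
        ∀ j : Fin 4, eval ![0, 0, t.rep 0, t.rep 1] (pderiv j F) = 0} with hS
  have hfin : S.Finite := Set.finite_of_ncard_ne_zero (by rw [hsing4]; norm_num)
  set s := hfin.toFinset with hs
  have hcard : s.card = 4 := by rw [← hsing4, Set.ncard_eq_toFinset_card S hfin]
  set p := restrictToL (pderiv 0 F) with hp
  set q := restrictToL (pderiv 1 F) with hq
  have hph : p.IsHomogeneous 5 := restrict_hom (pderiv_hom hF 0)
  have hqh : q.IsHomogeneous 5 := restrict_hom (pderiv_hom hF 1)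
  have hF0 : restrictToL F = 0 := MvPolynomial.funext fun v => by
    rw [eval_restrict, hLS]; simp
  have hz : ∀ i : Fin 2, restrictToL (pderiv (Fin.natAdd 2 i) F) = 0 := fun i => by
    rw [← pderiv_restrict, hF0, map_zero]
  -- singular points on the line are the common zeros of p and q
  have hsing : ∀ v : Fin 2 → ℂ, (∀ j : Fin 4, eval ![0, 0, v 0, v 1] (pderiv j F) = 0) ↔
      (eval v p = 0 ∧ eval v q = 0) := by
    intro v
    rw [hp, hq, eval_restrict, eval_restrict]
    refine ⟨fun h => ⟨h 0, h 1⟩, fun h j => ?_⟩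
    have h2 := congrArg (eval v) (hz 0)
    have h3 := congrArg (eval v) (hz 1)
    rw [eval_restrict, map_zero] at h2 h3
    fin_cases j
    · exact h.1
    · exact h.2
    · exact h2
    · exact h3
  have hscale : ∀ (f : MvPolynomial (Fin 2) ℂ), f.IsHomogeneous 5 → ∀ (c : ℂ) (v : Fin 2 → ℂ),
      eval (c • v) f = c ^ 5 * eval v f := by
    intro f hf c v
    have := aeval_mul_hom hf c v
    simpa [aeval_eq_eval, ← Pi.smul_def, ← smul_eq_mul] using this
  have hmem : ∀ t, t ∈ s ↔ (eval t.rep p = 0 ∧ eval t.rep q = 0) := by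
    intro t
    rw [hs, Set.Finite.mem_toFinset, hS, Set.mem_ofPred_eq, hsing]
  have hdet : ∀ (t : Projectivization ℂ (Fin 2 → ℂ)) (v : Fin 2 → ℂ),
      t.rep 1 * v 0 - t.rep 0 * v 1 = 0 → ∃ c : ℂ, v = c • t.rep := by
    intro t v h
    have hne := t.rep_nonzero
    by_cases h0 : t.rep 0 = 0
    · have h1 : t.rep 1 ≠ 0 := by
        intro h1
        apply hne
        ext i; fin_cases i
        · exact h0
        · exact h1
      refine ⟨v 1 / t.rep 1, ?_⟩
      ext i; fin_cases i
      · simp [h0] at h ⊢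
        tauto
      · simp [h1]
    · refine ⟨v 0 / t.rep 0, ?_⟩
      ext i; fin_cases i
      · simp [h0]
      · simp
        field_simp
        linear_combination -h
  set g : MvPolynomial (Fin 2) ℂ := ∏ t ∈ s, lin t.rep with hg
  have hrel : Set.Pairwise (s : Set (Projectivization ℂ (Fin 2 → ℂ)))
      (Function.onFun IsRelPrime fun t => lin t.rep) := by
    intro t _ u _ htu
    apply lin_relPrime
    intro h
    apply htu
    obtain ⟨c, hc⟩ := hdet u t.rep h
    rw [← t.mk_rep, ← u.mk_rep, Projectivization.mk_eq_mk_iff']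
    exact ⟨c, hc.symm⟩
  have hghom : g.IsHomogeneous 4 := by
    have := IsHomogeneous.prod s (fun t => lin t.rep) (fun _ => 1) (fun t _ => lin_hom t.rep)
    simpa [hcard] using this
  have hgp : g ∣ p := Finset.prod_dvd_of_isRelPrime hrel fun t ht =>
    lin_dvd hph t.rep_nonzero ((hmem t).1 ht).1
  have hgq : g ∣ q := Finset.prod_dvd_of_isRelPrime hrel fun t ht =>
    lin_dvd hqh t.rep_nonzero ((hmem t).1 ht).2
  have hzero : ∀ v : Fin 2 → ℂ, v ≠ 0 → (eval v g = 0 ↔ (eval v p = 0 ∧ eval v q = 0)) := by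
    intro v hv
    constructor
    · intro h
      rw [hg, map_prod, Finset.prod_eq_zero_iff] at h
      obtain ⟨t, ht, h⟩ := h
      rw [eval_lin] at h
      obtain ⟨c, rfl⟩ := hdet t v h
      rw [hscale p hph, hscale q hqh, ((hmem t).1 ht).1, ((hmem t).1 ht).2]
      simp
    · rintro ⟨h1, h2⟩
      obtain ⟨a, ha⟩ := Projectivization.exists_smul_eq_mk_rep ℂ v hv
      have ha' : (a : ℂ) • v = (Projectivization.mk ℂ v hv).rep := ha
      rw [hg, map_prod, Finset.prod_eq_zero_iff]
      refine ⟨Projectivization.mk ℂ v hv, ?_, ?_⟩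
      · rw [hmem, ← ha', hscale p hph, hscale q hqh, h1, h2]; simp
      · rw [eval_lin, ← ha']; simp; ring
  have hsq : Squarefree g := Finset.squarefree_prod_of_pairwise_isCoprime hrel
    fun t _ => lin_sqfree t.rep_nonzero
  have hnd : ∀ u : Fin 2 → ℂ, u ≠ 0 → eval u p = 0 → eval u q = 0 →
      (∀ i, eval u (pderiv i p) = 0) → (∀ i, eval u (pderiv i q) = 0) → False := by
    intro u hu h1 h2 h3 h4
    have hr := hnode u hu ((hsing u).2 ⟨h1, h2⟩)
    have hle := rank_block (Matrix.of fun (i j : Fin 4) =>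
        eval ![0, 0, u 0, u 1] (pderiv i (pderiv j F))) (by
      have hA : ∀ (i : Fin 2) (j : Fin 4),
          eval ![0, 0, u 0, u 1] (pderiv (Fin.natAdd 2 i) (pderiv j F)) = 0 := by
        intro i j
        rw [← eval_restrict, ← pderiv_restrict]
        fin_cases j
        · exact h3 i
        · exact h4 i
        · exact (congrArg (fun f => eval u (pderiv i f)) (hz 0)).trans (by simp)
        · exact (congrArg (fun f => eval u (pderiv i f)) (hz 1)).trans (by simp)
      have hB : ∀ i : Fin 4, 2 ≤ i.val → ∃ k : Fin 2, i = Fin.natAdd 2 k := by decide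
      rintro i j (h | h)
      · obtain ⟨k, rfl⟩ := hB i h
        exact hA k j
      · obtain ⟨k, rfl⟩ := hB j h
        rw [Matrix.of_apply, pderiv_swap]
        exact hA k i)
    omega
  obtain ⟨a, b, hab⟩ := hom_quot hghom hph hgp
  obtain ⟨c, d, hcd⟩ := hom_quot hghom hqh hgq
  have hD : a * d - b * c ≠ 0 := by
    intro hD
    obtain ⟨u, hu, hu1, hu2⟩ : ∃ u : Fin 2 → ℂ, u ≠ 0 ∧ a * u 0 + b * u 1 = 0 ∧
        c * u 0 + d * u 1 = 0 := by
      by_cases h1 : a = 0 ∧ b = 0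
      · by_cases h2 : c = 0 ∧ d = 0
        · exact ⟨![1, 0], by simp, by simp [h1], by simp [h2]⟩
        · refine ⟨![d, -c], by simpa [and_comm] using h2, by simp [h1], by simp; ring⟩
      · refine ⟨![b, -a], by simpa [and_comm] using h1, by simp; ring, ?_⟩
        simp; linear_combination -hD
    have e1 : eval u (C a * X 0 + C b * X 1) = 0 := by simpa using hu1
    have e2 : eval u (C c * X 0 + C d * X 1) = 0 := by simpa using hu2
    have hp0 : eval u p = 0 := by rw [hab, map_mul, e1, mul_zero]
    have hq0 : eval u q = 0 := by rw [hcd, map_mul, e2, mul_zero]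
    have hg0 := (hzero u hu).2 ⟨hp0, hq0⟩
    refine hnd u hu hp0 hq0 (fun i => ?_) (fun i => ?_)
    · rw [hab, pderiv_mul, map_add, map_mul, map_mul, e1, hg0]; simp
    · rw [hcd, pderiv_mul, map_add, map_mul, map_mul, e2, hg0]; simp
  refine ⟨g, hgp, hgq, ?_, hsq, hsq.ne_zero, hghom, fun v hv => ?_⟩
  · intro h h1 h2
    rw [hab] at h1
    rw [hcd] at h2
    obtain ⟨h3, h4⟩ := dvd_X_of_det hD h1 h2
    exact dvd_of_dvd_X h3 h4
  · rw [hzero v hv, hsing]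
end
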